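/- Let r ≥ 3 and q = C(r+1,2) + 1 = (r² + r + 2)/2. For every ε > 0 there exist ζ > 0 and n₀ such that for all n ≥ n₀ with r | n: if G is an n-vertex graph with minimum degree δ(G) ≥ ((r²+1)/(r²+r+2) + ε)·n and f : E(G) → {1,…,q} is any q-edge-coloring of G, then there is a K_r-tiling T of G and a color c such that c appears on at least (e(T) + ζn)/q of the edges of T. In other words, δ_{r,q} ≤ (r²+1)/(r²+r+2) when q = C(r+1,2)+1. -/

import Mathlib

open Finset

variable {V : Type*}

/-- A `Kᵣ`-tiling of the vertex set `W`: a collection of pairwise-disjoint `r`-cliques of `G`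
whose union is `W`. -/
def IsKrTilingOn [DecidableEq V] (G : SimpleGraph V) (r : ℕ)
    (T : Finset (Finset V)) (W : Finset V) : Prop :=
  (∀ K ∈ T, G.IsNClique r K) ∧
  (∀ K ∈ T, ∀ K' ∈ T, K ≠ K' → Disjoint K K') ∧
  T.biUnion id = W

/-- A perfect `Kᵣ`-tiling of `G`. -/
def IsKrTiling [Fintype V] [DecidableEq V] (G : SimpleGraph V) (r : ℕ)
    (T : Finset (Finset V)) : Prop :=
  IsKrTilingOn G r T Finset.univ

/-- The number of edges of color `c` lying inside the cliques of `T`. -/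
def tilingColorCount [DecidableEq V] {q : ℕ} (f : Sym2 V → Fin q)
    (T : Finset (Finset V)) (c : Fin q) : ℕ :=
  ∑ K ∈ T, (K.sym2.filter fun e => ¬ e.IsDiag ∧ f e = c).card

/-- The total number of edges lying inside the cliques of `T`. -/
def tilingEdgeCount [DecidableEq V] (T : Finset (Finset V)) : ℕ :=
  ∑ K ∈ T, (K.sym2.filter fun e => ¬ e.IsDiag).card


set_option linter.unusedSectionVars false

namespace KrHS
open scoped Classical

variable {V : Type*} [DecidableEq V]

/-- color class -/
noncomputable def cls (W : Finset V) (f : V → ℕ) (i : ℕ) : Finset V := W.filter (fun x => f x = i)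

/-- neighbours inside a finset -/
noncomputable def nb (H : SimpleGraph V) (x : V) (S : Finset V) : Finset V := S.filter (fun y => H.Adj x y)

theorem mem_cls {W : Finset V} {f : V → ℕ} {i : ℕ} {x : V} : x ∈ cls W f i ↔ x ∈ W ∧ f x = i := by
  simp [cls]

theorem mem_nb {H : SimpleGraph V} {x y : V} {S : Finset V} : y ∈ nb H x S ↔ y ∈ S ∧ H.Adj x y := by
  simp [nb]

/-- proper coloring on `W` -/
def ProperOn (H : SimpleGraph V) (W : Finset V) (f : V → ℕ) : Prop :=
  ∀ x ∈ W, ∀ y ∈ W, H.Adj x y → f x ≠ f y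

/-- some vertex of class `i` is movable to class `j` -/
def Mv (H : SimpleGraph V) (W : Finset V) (f : V → ℕ) (i j : ℕ) : Prop :=
  ∃ y ∈ W, f y = i ∧ ∀ z ∈ W, f z = j → ¬ H.Adj y z

inductive Reach (H : SimpleGraph V) (W : Finset V) (f : V → ℕ) (a : ℕ) : Finset ℕ → ℕ → Prop
  | base (X : Finset ℕ) : a ∈ X → Reach H W f a X a
  | step (X : Finset ℕ) (i j : ℕ) : i ∈ X → Mv H W f i j → Reach H W f a (X.erase i) j →
      Reach H W f a X i

variable {H : SimpleGraph V} {W : Finset V} {f : V → ℕ} {a : ℕ}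

theorem Reach.mem {X : Finset ℕ} {i : ℕ} (h : Reach H W f a X i) : i ∈ X := by
  cases h <;> assumption

theorem Reach.mono {X Y : Finset ℕ} {i : ℕ} (h : Reach H W f a X i) (hXY : X ⊆ Y) :
    Reach H W f a Y i := by
  induction h generalizing Y with
  | base X ha => exact .base Y (hXY ha)
  | step X i j hi hm _ ih => exact .step Y i j (hXY hi) hm (ih (Finset.erase_subset_erase _ hXY))

theorem Reach.avoid {X : Finset ℕ} {j : ℕ} (h : Reach H W f a X j) (i : ℕ) :
    Reach H W f a (X.erase i) j ∨ Reach H W f a X i := by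
  induction h with
  | base X ha =>
    by_cases hi : i = a
    · subst hi; exact Or.inr (.base X ha)
    · exact Or.inl (.base _ (Finset.mem_erase.2 ⟨fun h => hi h.symm, ha⟩))
  | step X j k hj hm hk ih =>
    by_cases hij : j = i
    · subst hij; exact Or.inr (.step X j k hj hm hk)
    · rcases ih with ih | ih
      · left
        refine .step _ j k (Finset.mem_erase.2 ⟨hij, hj⟩) hm ?_
        rwa [Finset.erase_right_comm]
      · exact Or.inr (ih.mono (Finset.erase_subset _ _))

theorem Reach.cons {X : Finset ℕ} {i j : ℕ} (h : Reach H W f a X j) (hi : i ∈ X)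
    (hm : Mv H W f i j) : Reach H W f a X i := by
  rcases h.avoid i with h1 | h1
  · exact .step X i j hi hm h1
  · exact h1

theorem Reach.congr {W₁ : Finset V} {f₁ : V → ℕ} {X : Finset ℕ} {i : ℕ} (h : Reach H W f a X i)
    (hc : ∀ x, ∀ l ∈ X, (x ∈ W ∧ f x = l) ↔ (x ∈ W₁ ∧ f₁ x = l)) : Reach H W₁ f₁ a X i := by
  induction h with
  | base X ha => exact .base X ha
  | step X i j hi hm hk ih =>
    refine .step X i j hi ?_ (ih fun x l hl => hc x l (Finset.mem_of_mem_erase hl))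
    obtain ⟨y, hy, hyi, hyz⟩ := hm
    have hj : j ∈ X := Finset.mem_of_mem_erase hk.mem
    obtain ⟨h1, h2⟩ := (hc y i hi).1 ⟨hy, hyi⟩
    refine ⟨y, h1, h2, fun z hz hzj => ?_⟩
    obtain ⟨h3, h4⟩ := (hc z j hj).2 ⟨hz, hzj⟩
    exact hyz z h3 h4

theorem Reach.filter {C X : Finset ℕ} {i : ℕ} (h : Reach H W f a X i) (hX : X ⊆ C) :
    Reach H W f a (X.filter (fun l => Reach H W f a C l)) i := by
  induction h with
  | base X ha => exact .base _ (Finset.mem_filter.2 ⟨ha, .base _ (hX ha)⟩)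
  | step X i j hi hm hk ih =>
    have h1 : Reach H W f a C i := (Reach.step X i j hi hm hk).mono hX
    refine .step _ i j (Finset.mem_filter.2 ⟨hi, h1⟩) hm ?_
    refine (ih ((Finset.erase_subset _ _).trans hX)).mono ?_
    intro l hl
    simp only [Finset.mem_filter, Finset.mem_erase] at hl ⊢
    tauto

theorem insert_shift (n : ℕ) : ∀ (X : Finset ℕ), X.card = n → ∀ (W : Finset V) (f : V → ℕ) (i : ℕ)
    (x₀ : V), Reach H W f a X i → x₀ ∉ W → (∀ z ∈ W, f z = i → ¬ H.Adj x₀ z) → ProperOn H W f →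
    ∃ f' : V → ℕ, ProperOn H (insert x₀ W) f' ∧ (∀ x ∈ W, f x ∉ X → f' x = f x) ∧
      (∀ x ∈ W, f x ∈ X → f' x ∈ X) ∧ f' x₀ ∈ X ∧
      (∀ l, l ≠ a → (cls (insert x₀ W) f' l).card = (cls W f l).card) ∧
      (cls (insert x₀ W) f' a).card = (cls W f a).card + 1 := by
  induction n with
  | zero =>
    intro X hX W f i x₀ h
    rw [Finset.card_eq_zero] at hX
    subst hX
    exact absurd h.mem (Finset.notMem_empty _)
  | succ n IH =>
    intro X hX W f i x₀ h hx₀ hadj hp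
    have key : ∀ x ∈ W, x ≠ x₀ := fun x hx h => hx₀ (h ▸ hx)
    cases h with
    | base _ ha =>
      refine ⟨Function.update f x₀ a, ?_, ?_, ?_, ?_, ?_, ?_⟩
      · intro x hx y hy hxy
        rcases Finset.mem_insert.1 hx with hx' | hx'
        · rcases Finset.mem_insert.1 hy with hy' | hy'
          · rw [hx', hy'] at hxy
            exact absurd hxy (H.irrefl)
          · rw [hx', Function.update_self, Function.update_of_ne (key y hy')]
            exact fun h => hadj y hy' h.symm (hx' ▸ hxy)
        · rcases Finset.mem_insert.1 hy with hy' | hy'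
          · rw [hy', Function.update_self, Function.update_of_ne (key x hx')]
            exact fun h => hadj x hx' h (hy' ▸ hxy.symm)
          · rw [Function.update_of_ne (key x hx'), Function.update_of_ne (key y hy')]
            exact hp x hx' y hy' hxy
      · intro x hx _
        rw [Function.update_of_ne (key x hx)]
      · intro x hx h
        rwa [Function.update_of_ne (key x hx)]
      · rwa [Function.update_self]
      · intro l hl
        congr 1
        ext x
        simp only [mem_cls, Finset.mem_insert]
        by_cases hx : x = x₀
        · subst hx; simp [hx₀, hl.symm]
        · simp [hx]
      · have : cls (insert x₀ W) (Function.update f x₀ a) a = insert x₀ (cls W f a) := by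
          ext x
          simp only [mem_cls, Finset.mem_insert]
          by_cases hx : x = x₀
          · subst hx; simp
          · simp [hx]
        rw [this, Finset.card_insert_of_notMem (by simp [mem_cls, hx₀])]
    | step _ _ j hi hm hk =>
      obtain ⟨y, hy, hyi, hyz⟩ := hm
      have hyx : y ≠ x₀ := key y hy
      have hji : j ≠ i := (Finset.mem_erase.1 hk.mem).1
      set W₁ := (insert x₀ W).erase y with hW₁
      set f₁ := Function.update f x₀ i with hf₁
      have hins : insert y W₁ = insert x₀ W := Finset.insert_erase (Finset.mem_insert_of_mem hy)
      have hmem : ∀ x, x ∈ W₁ ↔ x ≠ y ∧ (x = x₀ ∨ x ∈ W) := by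
        intro x; simp [hW₁]
      have hf₁x : f₁ x₀ = i := by simp [hf₁]
      have hf₁o : ∀ x ∈ W, f₁ x = f x := fun x hx => by
        simp [hf₁, Function.update_of_ne (key x hx)]
      have hc : ∀ x, ∀ l, l ≠ i → ((x ∈ W ∧ f x = l) ↔ (x ∈ W₁ ∧ f₁ x = l)) := by
        intro x l hl
        rw [hmem]
        constructor
        · rintro ⟨h1, h2⟩
          refine ⟨⟨?_, Or.inr h1⟩, by rw [hf₁o x h1, h2]⟩
          rintro rfl; exact hl (h2.symm.trans hyi)
        · rintro ⟨⟨h1, rfl | h2⟩, h3⟩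
          · exact absurd (h3.symm.trans hf₁x) hl
          · exact ⟨h2, by rw [← hf₁o x h2, h3]⟩
      have hk' : Reach H W₁ f₁ a (X.erase i) j :=
        hk.congr fun x l hl => hc x l (Finset.mem_erase.1 hl).1
      obtain ⟨f', p1, p2, p3, p4, p5, p6⟩ := IH (X.erase i)
        (by rw [Finset.card_erase_of_mem hi, hX]; rfl) W₁ f₁ j y hk' (by simp [hW₁])
        (by
          intro z hz hzj
          obtain ⟨h1, h2⟩ := (hc z j hji).2 ⟨hz, hzj⟩
          exact hyz z h1 h2)
        (by
          intro u hu v hv huv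
          rw [hmem] at hu hv
          rcases hu with ⟨hu1, rfl | hu2⟩
          · rcases hv with ⟨hv1, rfl | hv2⟩
            · exact absurd huv H.irrefl
            · rw [hf₁x, hf₁o v hv2]
              exact fun h => hadj v hv2 h.symm huv
          · rcases hv with ⟨hv1, rfl | hv2⟩
            · rw [hf₁x, hf₁o u hu2]
              exact fun h => hadj u hu2 h huv.symm
            · rw [hf₁o u hu2, hf₁o v hv2]
              exact hp u hu2 v hv2 huv)
      have hcard : ∀ l, (cls W₁ f₁ l).card = (cls W f l).card := by
        intro l
        by_cases hl : l = i
        · subst hl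
          have : cls W₁ f₁ l = insert x₀ ((cls W f l).erase y) := by
            ext x
            simp only [mem_cls, Finset.mem_insert, Finset.mem_erase, hmem]
            constructor
            · rintro ⟨⟨h1, rfl | h2⟩, h3⟩
              · exact Or.inl rfl
              · exact Or.inr ⟨h1, h2, by rw [← hf₁o x h2, h3]⟩
            · rintro (rfl | ⟨h1, h2, h3⟩)
              · exact ⟨⟨hyx.symm, Or.inl rfl⟩, hf₁x⟩
              · exact ⟨⟨h1, Or.inr h2⟩, by rw [hf₁o x h2, h3]⟩
          rw [this, Finset.card_insert_of_notMem (by simp [mem_cls, hx₀])]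
          exact Finset.card_erase_add_one (mem_cls.2 ⟨hy, hyi⟩)
        · congr 1
          ext x
          rw [mem_cls, mem_cls]
          exact (hc x l hl).symm
      rw [hins] at p1 p5 p6
      refine ⟨f', p1, ?_, ?_, ?_, ?_, ?_⟩
      · intro x hx hfx
        have hxy : x ≠ y := by rintro rfl; exact hfx (hyi ▸ hi)
        have := p2 x ((hmem x).2 ⟨hxy, Or.inr hx⟩)
          (by rw [hf₁o x hx]; exact fun h => hfx (Finset.mem_of_mem_erase h))
        rw [this, hf₁o x hx]
      · intro x hx hfx
        by_cases hxy : x = y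
        · subst hxy; exact Finset.mem_of_mem_erase p4
        · by_cases hxi : f x = i
          · have := p2 x ((hmem x).2 ⟨hxy, Or.inr hx⟩) (by rw [hf₁o x hx, hxi]; simp)
            rw [this, hf₁o x hx]; exact hfx
          · exact Finset.mem_of_mem_erase (p3 x ((hmem x).2 ⟨hxy, Or.inr hx⟩)
              (by rw [hf₁o x hx]; exact Finset.mem_erase.2 ⟨hxi, hfx⟩))
      · have := p2 x₀ ((hmem x₀).2 ⟨hyx.symm, Or.inl rfl⟩) (by rw [hf₁x]; simp)
        rw [this, hf₁x]; exact hi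
      · intro l hl
        rw [p5 l hl, hcard]
      · rw [p6, hcard]

end KrHS

namespace KrHS
open scoped Classical

variable {V : Type*} [DecidableEq V]

structure Near (H : SimpleGraph V) (W : Finset V) (C : Finset ℕ) (s : ℕ) (f : V → ℕ) (a b : ℕ) :
    Prop where
  mem : ∀ x ∈ W, f x ∈ C
  proper : ProperOn H W f
  ha : a ∈ C
  hb : b ∈ C
  hab : a ≠ b
  ca : (cls W f a).card + 1 = s
  cb : (cls W f b).card = s + 1
  co : ∀ i ∈ C, i ≠ a → i ≠ b → (cls W f i).card = s

/-- equitable coloring -/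
def Equit (H : SimpleGraph V) (W : Finset V) (C : Finset ℕ) (s : ℕ) (f : V → ℕ) : Prop :=
  (∀ x ∈ W, f x ∈ C) ∧ ProperOn H W f ∧ ∀ i ∈ C, (cls W f i).card = s

/-- accessible colors -/
noncomputable def acc (H : SimpleGraph V) (W : Finset V) (C : Finset ℕ) (f : V → ℕ) (a : ℕ) :
    Finset ℕ := C.filter (fun l => Reach H W f a C l)

/-- vertices with inaccessible colors -/
noncomputable def bad (H : SimpleGraph V) (W : Finset V) (C : Finset ℕ) (f : V → ℕ) (a : ℕ) :
    Finset V := W.filter (fun x => f x ∉ acc H W C f a)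

def Solo (H : SimpleGraph V) (W : Finset V) (f : V → ℕ) (y z : V) : Prop :=
  H.Adj y z ∧ ∀ u ∈ W, f u = f z → H.Adj y u → u = z

variable {H : SimpleGraph V} {W : Finset V} {C : Finset ℕ} {s : ℕ} {f : V → ℕ} {a b : ℕ}

theorem mem_acc {l : ℕ} : l ∈ acc H W C f a ↔ Reach H W f a C l := by
  simp only [acc, Finset.mem_filter, and_iff_right_iff_imp]
  exact fun h => h.mem

theorem acc_subset : acc H W C f a ⊆ C := Finset.filter_subset _ _

theorem mem_bad {x : V} : x ∈ bad H W C f a ↔ x ∈ W ∧ f x ∉ acc H W C f a := by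
  simp [bad]

theorem sum_cls (T : Finset ℕ) (S : Finset V) :
    (S.filter (fun x => f x ∈ T)).card = ∑ l ∈ T, (cls S f l).card := by
  rw [Finset.card_eq_sum_card_fiberwise (f := f) (t := T)]
  · refine Finset.sum_congr rfl fun l hl => ?_
    congr 1
    ext x
    simp only [mem_cls, Finset.mem_filter]
    constructor
    · rintro ⟨⟨h1, h2⟩, h3⟩; exact ⟨h1, h3⟩
    · rintro ⟨h1, h3⟩; exact ⟨⟨h1, h3 ▸ hl⟩, h3⟩
  · intro x hx
    simpa using (Finset.mem_filter.1 (Finset.mem_coe.1 hx)).2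

theorem nb_filter (x : V) (T : Finset ℕ) (S : Finset V) :
    (nb H x (S.filter (fun x => f x ∈ T))).card = ∑ l ∈ T, (nb H x (cls S f l)).card := by
  have : nb H x (S.filter (fun x => f x ∈ T)) = (nb H x S).filter (fun x => f x ∈ T) := by
    ext y; simp only [mem_nb, Finset.mem_filter]; tauto
  rw [this, sum_cls]
  refine Finset.sum_congr rfl fun l _ => ?_
  congr 1
  ext y; simp only [mem_nb, mem_cls]; tauto

theorem bad_eq (hmem : ∀ x ∈ W, f x ∈ C) :
    bad H W C f a = W.filter (fun x => f x ∈ C \ acc H W C f a) := by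
  ext x
  simp only [mem_bad, Finset.mem_filter, Finset.mem_sdiff]
  constructor
  · rintro ⟨h1, h2⟩; exact ⟨h1, hmem x h1, h2⟩
  · rintro ⟨h1, _, h2⟩; exact ⟨h1, h2⟩

theorem nb_total (hmem : ∀ x ∈ W, f x ∈ C) (x : V) :
    ∑ l ∈ acc H W C f a, (nb H x (cls W f l)).card + (nb H x (bad H W C f a)).card
      = (nb H x W).card := by
  rw [bad_eq hmem, nb_filter, add_comm, Finset.sum_sdiff acc_subset, ← nb_filter]
  congr 2
  ext y
  simp only [Finset.mem_filter]
  exact ⟨fun h => h.1, fun h => ⟨h, hmem y h⟩⟩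

theorem bad_nb (hmem : ∀ x ∈ W, f x ∈ C) {y : V} (hy : y ∈ bad H W C f a) {l : ℕ}
    (hl : l ∈ acc H W C f a) : 1 ≤ (nb H y (cls W f l)).card := by
  by_contra hcon
  have h0 : nb H y (cls W f l) = ∅ := by rw [← Finset.card_eq_zero]; omega
  have hyW := (mem_bad.1 hy).1
  apply (mem_bad.1 hy).2
  rw [mem_acc] at hl ⊢
  refine hl.cons (hmem y hyW) ⟨y, hyW, rfl, fun z hz hzl hyz => ?_⟩
  have : z ∈ nb H y (cls W f l) := mem_nb.2 ⟨mem_cls.2 ⟨hz, hzl⟩, hyz⟩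
  rw [h0] at this
  exact Finset.notMem_empty _ this

theorem bad_deg (hmem : ∀ x ∈ W, f x ∈ C) (hdeg : ∀ x ∈ W, (nb H x W).card < C.card) {y : V}
    (hy : y ∈ bad H W C f a) : (nb H y (bad H W C f a)).card < (C \ acc H W C f a).card := by
  have h1 := nb_total (H := H) (a := a) hmem y
  have h2 : (acc H W C f a).card ≤ ∑ l ∈ acc H W C f a, (nb H y (cls W f l)).card := by
    rw [Finset.card_eq_sum_ones]
    exact Finset.sum_le_sum fun l hl => bad_nb hmem hy hl
  have h3 := hdeg y (mem_bad.1 hy).1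
  have h4 : (acc H W C f a).card + (C \ acc H W C f a).card = C.card := by
    rw [Finset.card_sdiff_of_subset acc_subset]
    have := Finset.card_le_card (acc_subset (H := H) (W := W) (C := C) (f := f) (a := a))
    omega
  omega

theorem bad_card (hN : Near H W C s f a b) (hb : b ∉ acc H W C f a) :
    (bad H W C f a).card = (C \ acc H W C f a).card * s + 1 := by
  rw [bad_eq hN.mem, sum_cls]
  have hbm : b ∈ C \ acc H W C f a := Finset.mem_sdiff.2 ⟨hN.hb, hb⟩
  have haA : a ∈ acc H W C f a := mem_acc.2 (.base _ hN.ha)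
  rw [← Finset.add_sum_erase _ _ hbm, hN.cb, Finset.sum_congr rfl (g := fun _ => s)]
  · rw [Finset.sum_const, smul_eq_mul, Finset.card_erase_of_mem hbm]
    have : 1 ≤ (C \ acc H W C f a).card := Finset.card_pos.2 ⟨b, hbm⟩
    obtain ⟨k, hk⟩ := Nat.exists_eq_add_of_le this
    rw [hk]; simp; ring
  · intro l hl
    obtain ⟨h1, h2⟩ := Finset.mem_erase.1 hl
    obtain ⟨h3, h4⟩ := Finset.mem_sdiff.1 h2
    exact hN.co l h3 (fun h => h4 (h ▸ haA)) h1

/-- Lemma 1 -/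
theorem of_accessible (hN : Near H W C s f a b) (hb : b ∈ acc H W C f a) :
    ∃ f', Equit H W C s f' := by
  rw [mem_acc] at hb
  cases hb with
  | base => exact absurd rfl hN.hab
  | step _ _ j hi hm hk =>
    obtain ⟨y, hy, hyb, hyz⟩ := hm
    have hk' : Reach H (W.erase y) f a (C.erase b) j := by
      refine hk.congr fun x l hl => ?_
      have := (Finset.mem_erase.1 hl).1
      constructor
      · rintro ⟨h1, h2⟩
        refine ⟨Finset.mem_erase.2 ⟨?_, h1⟩, h2⟩
        rintro rfl; exact this (h2.symm.trans hyb)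
      · rintro ⟨h1, h2⟩; exact ⟨Finset.mem_of_mem_erase h1, h2⟩
    obtain ⟨f', p1, p2, p3, p4, p5, p6⟩ := insert_shift _ _ rfl (W.erase y) f j y hk' (by simp)
      (fun z hz => hyz z (Finset.mem_of_mem_erase hz))
      (fun u hu v hv => hN.proper u (Finset.mem_of_mem_erase hu) v (Finset.mem_of_mem_erase hv))
    rw [Finset.insert_erase hy] at p1 p5 p6
    have hcl : ∀ l, l ≠ b → cls (W.erase y) f l = cls W f l := by
      intro l hl
      ext x
      simp only [mem_cls, Finset.mem_erase]
      constructor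
      · rintro ⟨⟨_, h1⟩, h2⟩; exact ⟨h1, h2⟩
      · rintro ⟨h1, h2⟩
        refine ⟨⟨?_, h1⟩, h2⟩
        rintro rfl; exact hl (h2.symm.trans hyb)
    have hclb : (cls (W.erase y) f b).card = s := by
      have : cls (W.erase y) f b = (cls W f b).erase y := by
        ext x; simp only [mem_cls, Finset.mem_erase]; tauto
      rw [this, Finset.card_erase_of_mem (mem_cls.2 ⟨hy, hyb⟩), hN.cb]; rfl
    refine ⟨f', ?_, p1, ?_⟩
    · intro x hx
      by_cases hxy : x = y
      · subst hxy; exact Finset.mem_of_mem_erase p4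
      · have hx' : x ∈ W.erase y := Finset.mem_erase.2 ⟨hxy, hx⟩
        by_cases h : f x ∈ C.erase b
        · exact Finset.mem_of_mem_erase (p3 x hx' h)
        · rw [p2 x hx' h]; exact hN.mem x hx
    · intro i hi
      by_cases hia : i = a
      · subst hia; rw [p6, hcl _ hN.hab, hN.ca]
      · rw [p5 i hia]
        by_cases hib : i = b
        · subst hib; exact hclb
        · rw [hcl i hib]; exact hN.co i hi hia hib

def HSfor (V : Type*) [DecidableEq V] (s : ℕ) (C : Finset ℕ) : Prop :=
  ∀ (H : SimpleGraph V) (W : Finset V), W.card = C.card * s →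
    (∀ x ∈ W, (nb H x W).card < C.card) → ∃ f, Equit H W C s f

/-- recoloring of the inaccessible part without one vertex -/
theorem recolor (hN : Near H W C s f a b) (hb : b ∉ acc H W C f a)
    (hdeg : ∀ x ∈ W, (nb H x W).card < C.card)
    (IH : ∀ C' : Finset ℕ, C'.card < C.card → HSfor V s C') {y : V} (hy : y ∈ bad H W C f a) :
    ∃ g, Equit H ((bad H W C f a).erase y) (C \ acc H W C f a) s g := by
  have haA : a ∈ acc H W C f a := mem_acc.2 (.base _ hN.ha)
  apply IH
  · apply Finset.card_lt_card
    refine ⟨Finset.sdiff_subset, fun h => ?_⟩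
    exact (Finset.mem_sdiff.1 (h hN.ha)).2 haA
  · rw [Finset.card_erase_of_mem hy, bad_card hN hb]; rfl
  · intro x hx
    refine lt_of_le_of_lt (Finset.card_le_card ?_) (bad_deg hN.mem hdeg (Finset.mem_of_mem_erase hx))
    intro u hu
    rw [mem_nb] at hu ⊢
    exact ⟨Finset.mem_of_mem_erase hu.1, hu.2⟩

theorem case1 (hN : Near H W C s f a b) (hb : b ∉ acc H W C f a)
    (hdeg : ∀ x ∈ W, (nb H x W).card < C.card)
    (IH : ∀ C' : Finset ℕ, C'.card < C.card → HSfor V s C')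
    {w j : ℕ} (hw : w ∈ acc H W C f a) (hwa : w ≠ a) (hj : Reach H W f a (C.erase w) j)
    {z y : V} (hz : z ∈ W) (hzw : f z = w) (hy : y ∈ bad H W C f a) (hsolo : Solo H W f y z)
    (hzj : ∀ u ∈ W, f u = j → ¬ H.Adj z u) : ∃ f', Equit H W C s f' := by
  obtain ⟨g, g1, g2, g3⟩ := recolor hN hb hdeg IH hy
  set A := acc H W C f a with hA
  set B := bad H W C f a with hB
  have hyW := (mem_bad.1 hy).1
  have hyA : f y ∉ A := (mem_bad.1 hy).2
  have hj' : Reach H W f a (A.erase w) j := by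
    refine (hj.filter (Finset.erase_subset w C)).mono ?_
    intro l hl
    simp only [Finset.mem_filter, Finset.mem_erase] at hl ⊢
    exact ⟨hl.1.1, mem_acc.2 hl.2⟩
  have hj'' : Reach H (W.erase z) f a (A.erase w) j := by
    refine hj'.congr fun x l hl => ?_
    have := (Finset.mem_erase.1 hl).1
    constructor
    · rintro ⟨h1, h2⟩
      refine ⟨Finset.mem_erase.2 ⟨?_, h1⟩, h2⟩
      rintro rfl; exact this (h2.symm.trans hzw)
    · rintro ⟨h1, h2⟩; exact ⟨Finset.mem_of_mem_erase h1, h2⟩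
  obtain ⟨f', p1, p2, p3, p4, p5, p6⟩ := insert_shift _ _ rfl (W.erase z) f j z hj'' (by simp)
    (fun u hu => hzj u (Finset.mem_of_mem_erase hu))
    (fun u hu v hv => hN.proper u (Finset.mem_of_mem_erase hu) v (Finset.mem_of_mem_erase hv))
  rw [Finset.insert_erase hz] at p1 p5 p6
  -- facts on f'
  have q1 : ∀ x ∈ W, f x ∈ A → f' x ∈ A := by
    intro x hx hfx
    by_cases hxz : x = z
    · subst hxz; exact Finset.mem_of_mem_erase p4
    · have hx' : x ∈ W.erase z := Finset.mem_erase.2 ⟨hxz, hx⟩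
      by_cases h : f x = w
      · rw [p2 x hx' (by simp [h])]; exact hfx
      · exact Finset.mem_of_mem_erase (p3 x hx' (Finset.mem_erase.2 ⟨h, hfx⟩))
  have q2 : ∀ x ∈ W, f' x = w → f x = w ∧ x ≠ z := by
    intro x hx hfx
    have hxz : x ≠ z := by
      rintro rfl
      exact (Finset.mem_erase.1 p4).1 hfx
    refine ⟨?_, hxz⟩
    have hx' : x ∈ W.erase z := Finset.mem_erase.2 ⟨hxz, hx⟩
    by_cases h : f x ∈ A.erase w
    · exact absurd hfx (Finset.mem_erase.1 (p3 x hx' h)).1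
    · rw [← p2 x hx' h, hfx]
  have q3 : ∀ x ∈ W, f x ∉ A → f' x = f x := by
    intro x hx hfx
    have hxz : x ≠ z := by rintro rfl; exact hfx (hzw ▸ hw)
    exact p2 x (Finset.mem_erase.2 ⟨hxz, hx⟩) fun h => hfx (Finset.mem_of_mem_erase h)
  set F : V → ℕ := fun x => if x = y then w else if f x ∈ A then f' x else g x with hF
  have F1 : F y = w := by simp [hF]
  have F2 : ∀ x, x ≠ y → f x ∈ A → F x = f' x := by intro x h1 h2; simp [hF, h1, h2]
  have F3 : ∀ x, x ≠ y → f x ∉ A → F x = g x := by intro x h1 h2; simp [hF, h1, h2]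
  have F4 : ∀ x ∈ W, x ≠ y → f x ∉ A → x ∈ B.erase y := fun x h1 h2 h3 =>
    Finset.mem_erase.2 ⟨h2, mem_bad.2 ⟨h1, h3⟩⟩
  have yw : ∀ x ∈ W, x ≠ y → H.Adj y x → F x ≠ w := by
    intro x hx hxy hadj hFx
    by_cases h : f x ∈ A
    · rw [F2 x hxy h] at hFx
      obtain ⟨h1, h2⟩ := q2 x hx hFx
      exact h2 (hsolo.2 x hx (h1.trans hzw.symm) hadj)
    · rw [F3 x hxy h] at hFx
      exact (Finset.mem_sdiff.1 (g1 x (F4 x hx hxy h))).2 (hFx ▸ hw)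
  refine ⟨F, ?_, ?_, ?_⟩
  · intro x hx
    by_cases hxy : x = y
    · rw [hxy, F1]; exact acc_subset hw
    · by_cases h : f x ∈ A
      · rw [F2 x hxy h]; exact acc_subset (q1 x hx h)
      · rw [F3 x hxy h]; exact (Finset.mem_sdiff.1 (g1 x (F4 x hx hxy h))).1
  · intro u hu v hv huv
    by_cases hu1 : u = y
    · have hv1 : v ≠ y := by rintro rfl; rw [hu1] at huv; exact H.irrefl huv
      rw [hu1, F1]; exact (yw v hv hv1 (hu1 ▸ huv)).symm
    · by_cases hv1 : v = y
      · rw [hv1, F1]; exact yw u hu hu1 (hv1 ▸ huv.symm)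
      · by_cases hu2 : f u ∈ A <;> by_cases hv2 : f v ∈ A
        · rw [F2 u hu1 hu2, F2 v hv1 hv2]; exact p1 u hu v hv huv
        · rw [F2 u hu1 hu2, F3 v hv1 hv2]
          intro h
          exact (Finset.mem_sdiff.1 (g1 v (F4 v hv hv1 hv2))).2 (h ▸ q1 u hu hu2)
        · rw [F3 u hu1 hu2, F2 v hv1 hv2]
          intro h
          exact (Finset.mem_sdiff.1 (g1 u (F4 u hu hu1 hu2))).2 (h ▸ q1 v hv hv2)
        · rw [F3 u hu1 hu2, F3 v hv1 hv2]
          exact g2 u (F4 u hu hu1 hu2) v (F4 v hv hv1 hv2) huv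
  · intro i hi
    have hclz : ∀ l, l ≠ w → cls (W.erase z) f l = cls W f l := by
      intro l hl
      ext x
      simp only [mem_cls, Finset.mem_erase]
      constructor
      · rintro ⟨⟨_, h1⟩, h2⟩; exact ⟨h1, h2⟩
      · rintro ⟨h1, h2⟩
        refine ⟨⟨?_, h1⟩, h2⟩
        rintro rfl; exact hl (h2.symm.trans hzw)
    by_cases hiA : i ∈ A
    · have hib : i ≠ b := fun h => hb (h ▸ hiA)
      have base : ∀ x, x ≠ y → (x ∈ W ∧ F x = i ↔ x ∈ W ∧ f' x = i) := by
        intro x hxy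
        constructor
        · rintro ⟨h1, h2⟩
          refine ⟨h1, ?_⟩
          by_cases h : f x ∈ A
          · rwa [F2 x hxy h] at h2
          · rw [F3 x hxy h] at h2
            exact absurd hiA (h2 ▸ (Finset.mem_sdiff.1 (g1 x (F4 x h1 hxy h))).2)
        · rintro ⟨h1, h2⟩
          refine ⟨h1, ?_⟩
          by_cases h : f x ∈ A
          · rwa [F2 x hxy h]
          · rw [q3 x h1 h] at h2
            exact absurd hiA (h2 ▸ h)
      have hf'y : f' y ≠ i := by
        rw [q3 y hyW hyA]; intro h; exact hyA (h ▸ hiA)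
      by_cases hiw : i = w
      · have : cls W F i = insert y (cls W f' i) := by
          ext x
          rw [Finset.mem_insert, mem_cls, mem_cls]
          by_cases hxy : x = y
          · subst hxy; simp [hyW, F1, hiw]
          · rw [base x hxy]; simp [hxy]
        rw [this, Finset.card_insert_of_notMem (by simp [mem_cls, hf'y])]
        have hia : i ≠ a := hiw ▸ hwa
        rw [p5 i hia, ← hN.co i hi hia hib]
        have : cls (W.erase z) f i = (cls W f i).erase z := by
          ext x; simp only [mem_cls, Finset.mem_erase]; tauto
        rw [this]
        exact Finset.card_erase_add_one (mem_cls.2 ⟨hz, hzw.trans hiw.symm⟩)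
      · have : cls W F i = cls W f' i := by
          ext x
          rw [mem_cls, mem_cls]
          by_cases hxy : x = y
          · subst hxy; simp only [hyW, F1, true_and]
            constructor
            · intro h; exact absurd h.symm hiw
            · intro h; exact absurd h hf'y
          · exact base x hxy
        rw [this]
        by_cases hia : i = a
        · rw [hia, p6, hclz a hwa.symm, hN.ca]
        · rw [p5 i hia, hclz i hiw, hN.co i hi hia hib]
    · rw [← g3 i (Finset.mem_sdiff.2 ⟨hi, hiA⟩)]
      congr 1
      ext x
      rw [mem_cls, mem_cls]
      by_cases hxy : x = y
      · subst hxy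
        simp only [F1, Finset.mem_erase, ne_eq, not_true_eq_false, false_and, iff_false, not_and]
        intro _ h; exact hiA (h ▸ hw)
      · constructor
        · rintro ⟨h1, h2⟩
          by_cases h : f x ∈ A
          · rw [F2 x hxy h] at h2
            exact absurd (h2 ▸ q1 x h1 h) hiA
          · exact ⟨F4 x h1 hxy h, by rwa [← F3 x hxy h]⟩
        · rintro ⟨h1, h2⟩
          obtain ⟨h3, h4⟩ := mem_bad.1 (Finset.mem_of_mem_erase h1)
          exact ⟨h3, by rwa [F3 x hxy h4]⟩

end KrHS

namespace KrHS
open scoped Classical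

variable {V : Type*} [DecidableEq V]
variable {H : SimpleGraph V} {W : Finset V} {C : Finset ℕ} {s : ℕ} {f : V → ℕ} {a b : ℕ}

theorem case2 (hN : Near H W C s f a b) (hb : b ∉ acc H W C f a)
    (hdeg : ∀ x ∈ W, (nb H x W).card < C.card)
    (IH : ∀ C' : Finset ℕ, C'.card < C.card → HSfor V s C')
    {w : ℕ} (hw : w ∈ acc H W C f a) (hwa : w ≠ a)
    (hterm : ∀ j ∈ acc H W C f a, j ≠ w → Reach H W f a (C.erase w) j)
    {z y y₂ : V} (hz : z ∈ W) (hzw : f z = w) (hy : y ∈ bad H W C f a) (hsolo : Solo H W f y z)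
    (hy₂ : y₂ ∈ bad H W C f a) (hsolo₂ : Solo H W f y₂ z) (hyy : y ≠ y₂) (hnadj : ¬ H.Adj y y₂)
    (hzj : ∀ j ∈ acc H W C f a, j ≠ w → ∃ u ∈ W, f u = j ∧ H.Adj z u) :
    ∃ F b', Near H W C s F a b' ∧ acc H W C f a ⊂ acc H W C F a := by
  obtain ⟨g, g1, g2, g3⟩ := recolor hN hb hdeg IH hy
  have hAC : (acc H W C f a).card + (C \ acc H W C f a).card = C.card := by
    rw [Finset.card_sdiff_of_subset acc_subset]
    have := Finset.card_le_card (acc_subset (H := H) (W := W) (C := C) (f := f) (a := a))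
    omega
  have htot := nb_total (H := H) (a := a) hN.mem z
  have hzB : (nb H z ((bad H W C f a).erase y)).card < (C \ acc H W C f a).card := by
    have h1 : (acc H W C f a).card ≤ ∑ l ∈ acc H W C f a, (nb H z (cls W f l)).card + 1 := by
      rw [← Finset.card_erase_add_one hw, Finset.card_eq_sum_ones, ← Finset.add_sum_erase _ _ hw]
      have : ∑ x ∈ (acc H W C f a).erase w, 1 ≤
          ∑ x ∈ (acc H W C f a).erase w, (nb H z (cls W f x)).card := by
        refine Finset.sum_le_sum fun l hl => ?_
        obtain ⟨h2, h3⟩ := Finset.mem_erase.1 hl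
        obtain ⟨u, hu, hul, hzu⟩ := hzj l h3 h2
        exact Finset.card_pos.2 ⟨u, mem_nb.2 ⟨mem_cls.2 ⟨hu, hul⟩, hzu⟩⟩
      omega
    have h2 : nb H z ((bad H W C f a).erase y) = (nb H z (bad H W C f a)).erase y := by
      ext x; simp only [mem_nb, Finset.mem_erase]; tauto
    have h3 : y ∈ nb H z (bad H W C f a) := mem_nb.2 ⟨hy, hsolo.1.symm⟩
    have h4 := Finset.card_erase_add_one h3
    have h5 := hdeg z hz
    rw [h2]
    omega
  set A := acc H W C f a with hA
  set B := bad H W C f a with hB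
  have haA : a ∈ A := mem_acc.2 (.base _ hN.ha)
  have hyW := (mem_bad.1 hy).1
  have hyA : f y ∉ A := (mem_bad.1 hy).2
  have hzA : f z ∈ A := hzw ▸ hw
  have hzy : z ≠ y := by rintro rfl; exact hyA hzA
  obtain ⟨l, hl, hlz⟩ : ∃ l ∈ C \ A, ∀ x ∈ B.erase y, g x = l → ¬ H.Adj z x := by
    by_contra hcon
    push Not at hcon
    have : (C \ A).card ≤ (nb H z (B.erase y)).card := by
      have hsub : C \ A ⊆ (nb H z (B.erase y)).image g := by
        intro l hl
        obtain ⟨x, hx, hxl, hzx⟩ := hcon l hl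
        exact Finset.mem_image.2 ⟨x, mem_nb.2 ⟨hx, hzx⟩, hxl⟩
      exact (Finset.card_le_card hsub).trans Finset.card_image_le
    omega
  obtain ⟨hlC, hlA⟩ := Finset.mem_sdiff.1 hl
  set F : V → ℕ := fun x => if x = y then w else if x = z then l else if f x ∈ A then f x else g x
    with hF
  have F1 : F y = w := by simp [hF]
  have F0 : F z = l := by simp [hF, hzy]
  have F2 : ∀ x, x ≠ z → f x ∈ A → F x = f x := by
    intro x h1 h2
    have : x ≠ y := by rintro rfl; exact hyA h2
    simp [hF, h1, h2, this]
  have F3 : ∀ x, x ≠ y → f x ∉ A → F x = g x := by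
    intro x h1 h2
    have : x ≠ z := by rintro rfl; exact h2 hzA
    simp [hF, h1, h2, this]
  have F4 : ∀ x ∈ W, x ≠ y → f x ∉ A → x ∈ B.erase y := fun x h1 h2 h3 =>
    Finset.mem_erase.2 ⟨h2, mem_bad.2 ⟨h1, h3⟩⟩
  have F5 : ∀ x ∈ W, x ≠ y → f x ∉ A → F x ∈ C ∧ F x ∉ A := by
    intro x h1 h2 h3
    rw [F3 x h2 h3]
    exact Finset.mem_sdiff.1 (g1 x (F4 x h1 h2 h3))
  have yw : ∀ x ∈ W, x ≠ y → H.Adj y x → F x ≠ w := by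
    intro x hx hxy hadj hFx
    by_cases h : f x ∈ A
    · by_cases hxz : x = z
      · rw [hxz, F0] at hFx; exact hlA (hFx ▸ hw)
      · rw [F2 x hxz h] at hFx
        exact hxz (hsolo.2 x hx (hFx.trans hzw.symm) hadj)
    · exact (F5 x hx hxy h).2 (hFx ▸ hw)
  have zl : ∀ x ∈ W, H.Adj z x → F x ≠ l := by
    intro x hx hadj hFx
    have hxz : x ≠ z := by rintro rfl; exact H.irrefl hadj
    by_cases hxy : x = y
    · rw [hxy, F1] at hFx; exact hlA (hFx ▸ hw)
    · by_cases h : f x ∈ A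
      · rw [F2 x hxz h] at hFx; exact hlA (hFx ▸ h)
      · rw [F3 x hxy h] at hFx; exact hlz x (F4 x hx hxy h) hFx hadj
  -- classes
  have cA : ∀ i ∈ A, i ≠ w → ∀ x, (x ∈ W ∧ f x = i) ↔ (x ∈ W ∧ F x = i) := by
    intro i hiA hiw x
    constructor
    · rintro ⟨h1, h2⟩
      refine ⟨h1, ?_⟩
      have hxz : x ≠ z := by rintro rfl; exact hiw (h2.symm.trans hzw)
      rw [F2 x hxz (h2 ▸ hiA), h2]
    · rintro ⟨h1, h2⟩
      refine ⟨h1, ?_⟩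
      by_cases hxy : x = y
      · rw [hxy, F1] at h2; exact absurd h2.symm hiw
      · by_cases hxz : x = z
        · rw [hxz, F0] at h2; exact absurd hiA (h2 ▸ hlA)
        · by_cases h : f x ∈ A
          · rwa [F2 x hxz h] at h2
          · exact absurd hiA (h2 ▸ (F5 x h1 hxy h).2)
  have cw : cls W F w = insert y ((cls W f w).erase z) := by
    ext x
    simp only [Finset.mem_insert, mem_cls, Finset.mem_erase]
    constructor
    · rintro ⟨h1, h2⟩
      by_cases hxy : x = y
      · exact Or.inl hxy
      · right
        by_cases hxz : x = z
        · rw [hxz, F0] at h2; exact absurd hw (h2 ▸ hlA)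
        · by_cases h : f x ∈ A
          · rw [F2 x hxz h] at h2; exact ⟨hxz, h1, h2⟩
          · exact absurd hw (h2 ▸ (F5 x h1 hxy h).2)
    · rintro (rfl | ⟨h1, h2, h3⟩)
      · exact ⟨hyW, F1⟩
      · exact ⟨h2, by rw [F2 x h1 (h3 ▸ hw), h3]⟩
  have cB : ∀ i ∈ C, i ∉ A → i ≠ l → cls W F i = cls (B.erase y) g i := by
    intro i hi hiA hil
    ext x
    rw [mem_cls, mem_cls]
    constructor
    · rintro ⟨h1, h2⟩
      have hxy : x ≠ y := by rintro rfl; rw [F1] at h2; exact hiA (h2 ▸ hw)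
      have hxz : x ≠ z := by rintro rfl; rw [F0] at h2; exact hil h2.symm
      by_cases h : f x ∈ A
      · rw [F2 x hxz h] at h2; exact absurd (h2 ▸ h) hiA
      · exact ⟨F4 x h1 hxy h, by rwa [← F3 x hxy h]⟩
    · rintro ⟨h1, h2⟩
      obtain ⟨h3, h4⟩ := mem_bad.1 (Finset.mem_of_mem_erase h1)
      exact ⟨h3, by rwa [F3 x (Finset.mem_erase.1 h1).1 h4]⟩
  have cl : cls W F l = insert z (cls (B.erase y) g l) := by
    ext x
    rw [Finset.mem_insert, mem_cls, mem_cls]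
    constructor
    · rintro ⟨h1, h2⟩
      have hxy : x ≠ y := by rintro rfl; rw [F1] at h2; exact hlA (h2 ▸ hw)
      by_cases hxz : x = z
      · exact Or.inl hxz
      · right
        by_cases h : f x ∈ A
        · rw [F2 x hxz h] at h2; exact absurd (h2 ▸ h) hlA
        · exact ⟨F4 x h1 hxy h, by rwa [← F3 x hxy h]⟩
    · rintro (rfl | ⟨h1, h2⟩)
      · exact ⟨hz, F0⟩
      · obtain ⟨h3, h4⟩ := mem_bad.1 (Finset.mem_of_mem_erase h1)
        exact ⟨h3, by rwa [F3 x (Finset.mem_erase.1 h1).1 h4]⟩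
  have hcA : ∀ i ∈ A, i ≠ w → cls W F i = cls W f i := by
    intro i h1 h2
    ext x
    rw [mem_cls, mem_cls]
    exact (cA i h1 h2 x).symm
  refine ⟨F, l, ⟨?_, ?_, hN.ha, hlC, fun h => hlA (h ▸ haA), ?_, ?_, ?_⟩, ?_⟩
  · intro x hx
    by_cases hxy : x = y
    · rw [hxy, F1]; exact acc_subset hw
    · by_cases hxz : x = z
      · rw [hxz, F0]; exact hlC
      · by_cases h : f x ∈ A
        · rw [F2 x hxz h]; exact acc_subset h
        · exact (F5 x hx hxy h).1
  · intro u hu v hv huv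
    by_cases hu1 : u = y
    · have hv1 : v ≠ y := by rintro rfl; rw [hu1] at huv; exact H.irrefl huv
      rw [hu1, F1]; exact (yw v hv hv1 (hu1 ▸ huv)).symm
    by_cases hv1 : v = y
    · rw [hv1, F1]; exact yw u hu hu1 (hv1 ▸ huv.symm)
    by_cases hu0 : u = z
    · rw [hu0, F0]; exact (zl v hv (hu0 ▸ huv)).symm
    by_cases hv0 : v = z
    · rw [hv0, F0]; exact zl u hu (hv0 ▸ huv.symm)
    by_cases hu2 : f u ∈ A <;> by_cases hv2 : f v ∈ A
    · rw [F2 u hu0 hu2, F2 v hv0 hv2]; exact hN.proper u hu v hv huv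
    · rw [F2 u hu0 hu2]
      intro h
      exact (F5 v hv hv1 hv2).2 (h ▸ hu2)
    · rw [F2 v hv0 hv2]
      intro h
      exact (F5 u hu hu1 hu2).2 (h ▸ hv2)
    · rw [F3 u hu1 hu2, F3 v hv1 hv2]
      exact g2 u (F4 u hu hu1 hu2) v (F4 v hv hv1 hv2) huv
  · rw [hcA a haA hwa.symm, hN.ca]
  · rw [cl, Finset.card_insert_of_notMem, g3 l hl]
    rw [mem_cls]
    rintro ⟨h1, _⟩
    exact (mem_bad.1 (Finset.mem_of_mem_erase h1)).2 hzA
  · intro i hi hia hil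
    by_cases hiA : i ∈ A
    · have hib : i ≠ b := fun h => hb (h ▸ hiA)
      by_cases hiw : i = w
      · rw [hiw, cw, Finset.card_insert_of_notMem]
        · rw [Finset.card_erase_add_one (mem_cls.2 ⟨hz, hzw⟩), ← hiw, hN.co i hi hia hib]
        · simp only [Finset.mem_erase, mem_cls, not_and]
          intro _ _ h
          exact hyA (h ▸ hw)
      · rw [hcA i hiA hiw, hN.co i hi hia hib]
    · rw [cB i hi hiA hil, g3 i (Finset.mem_sdiff.2 ⟨hi, hiA⟩)]
  · have r1 : ∀ j ∈ A, j ≠ w → Reach H W F a (C.erase w) j := by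
      intro j hj hjw
      have h1 := (hterm j hj hjw).filter (Finset.erase_subset w C)
      have h2 := h1.congr (W₁ := W) (f₁ := F) (by
        intro x i hi
        obtain ⟨h2, h3⟩ := Finset.mem_filter.1 hi
        exact cA i (mem_acc.2 h3) (Finset.mem_erase.1 h2).1 x)
      exact h2.mono (Finset.filter_subset _ _)
    have r2 : Reach H W F a C w := by
      have hw' := mem_acc.1 hw
      cases hw' with
      | base => exact absurd rfl hwa
      | step _ _ j hi hm hk =>
        have hjw : j ≠ w := (Finset.mem_erase.1 hk.mem).1
        have hjA : j ∈ A := mem_acc.2 (hk.mono (Finset.erase_subset _ _))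
        obtain ⟨y', hy', hyw', hyz'⟩ := hm
        refine .step _ w j hi ⟨y', hy', ?_, ?_⟩ (r1 j hjA hjw)
        · have : y' ≠ z := by
            rintro rfl
            obtain ⟨u, hu, huj, hzu⟩ := hzj j hjA hjw
            exact hyz' u hu huj hzu
          rw [F2 y' this (hyw' ▸ hw), hyw']
        · intro u hu huj
          obtain ⟨h1, h2⟩ := (cA j hjA hjw u).2 ⟨hu, huj⟩
          exact hyz' u h1 h2
    obtain ⟨hy₂W, hy₂A⟩ := mem_bad.1 hy₂
    have hF₂ := F5 y₂ hy₂W hyy.symm hy₂A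
    have r3 : Reach H W F a C (F y₂) := by
      refine r2.cons hF₂.1 ⟨y₂, hy₂W, rfl, ?_⟩
      intro u hu huw hadj
      have : u ∈ cls W F w := mem_cls.2 ⟨hu, huw⟩
      rw [cw] at this
      rcases Finset.mem_insert.1 this with h | h
      · exact hnadj (h ▸ hadj.symm)
      · obtain ⟨h1, h2⟩ := Finset.mem_erase.1 h
        exact h1 (hsolo₂.2 u hu ((mem_cls.1 h2).2.trans hzw.symm) hadj)
    refine ⟨?_, fun h => hF₂.2 (h (mem_acc.2 r3))⟩
    intro j hj
    by_cases hjw : j = w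
    · rw [hjw]; exact mem_acc.2 r2
    · exact mem_acc.2 ((r1 j hj hjw).mono (Finset.erase_subset _ _))

/-- the family of terminal classes -/
theorem terminal (haC : a ∈ C) (hne : ∃ i ∈ acc H W C f a, i ≠ a) :
    ∃ A' : Finset ℕ, A' ⊆ acc H W C f a ∧ A'.Nonempty ∧ a ∉ A' ∧
      (∀ w ∈ A', ∀ j ∈ acc H W C f a, j ≠ w → Reach H W f a (C.erase w) j) ∧
      ∃ U, U ∈ acc H W C f a ∧ U ∉ A' ∧
        ∀ j ∈ A', ∀ k ∈ acc H W C f a, k ∉ A' → k ≠ U → ¬ Mv H W f j k := by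
  set A := acc H W C f a with hA
  set T : ℕ → Finset ℕ := fun U => (A.erase U).filter (fun j => ¬ Reach H W f a (C.erase U) j) with hT
  have memT : ∀ U j, j ∈ T U ↔ (j ≠ U ∧ j ∈ A) ∧ ¬ Reach H W f a (C.erase U) j := by
    intro U j; simp [hT]
  have haA : a ∈ A := mem_acc.2 (.base _ haC)
  have hcand : ((A.filter fun U => (T U).Nonempty)).Nonempty := by
    obtain ⟨i, hi, hia⟩ := hne
    refine ⟨a, Finset.mem_filter.2 ⟨haA, i, ?_⟩⟩
    rw [memT]
    refine ⟨⟨hia, hi⟩, fun h => ?_⟩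
    have : ∀ X j, Reach H W f a X j → a ∈ X := by
      intro X j h
      induction h with
      | base X h => exact h
      | step X i j _ _ _ ih => exact Finset.mem_of_mem_erase ih
    exact absurd (this _ _ h) (by simp)
  obtain ⟨U, hU, hmin⟩ := Finset.exists_min_image _ (fun U => (T U).card) hcand
  obtain ⟨hUA, hUne⟩ := Finset.mem_filter.1 hU
  have S1 : ∀ j ∈ A, j ≠ U → j ∉ T U → Reach H W f a (C.erase U) j := by
    intro j h1 h2 h3
    by_contra h
    exact h3 ((memT U j).2 ⟨⟨h2, h1⟩, h⟩)
  refine ⟨T U, fun j hj => ((memT U j).1 hj).1.2, hUne, ?_, ?_, U, hUA, ?_, ?_⟩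
  · intro h
    obtain ⟨⟨h1, _⟩, h3⟩ := (memT U a).1 h
    exact h3 (.base _ (Finset.mem_erase.2 ⟨h1, haC⟩))
  · intro w hw j hj hjw
    obtain ⟨⟨hwU, hwA⟩, hwR⟩ := (memT U w).1 hw
    by_contra hcon
    have hjT : j ∈ T w := (memT w j).2 ⟨⟨hjw, hj⟩, hcon⟩
    have h1 := hmin w (Finset.mem_filter.2 ⟨hwA, j, hjT⟩)
    have hS : ∀ k, Reach H W f a (C.erase U) k → Reach H W f a ((C.erase w).erase U) k := by
      intro k hk
      rcases hk.avoid w with h | h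
      · rwa [Finset.erase_right_comm]
      · exact absurd h hwR
    have hsub : T w ⊂ T U := by
      refine ⟨?_, fun h => ?_⟩
      · intro k hk
        obtain ⟨⟨hkw, hkA⟩, hkR⟩ := (memT w k).1 hk
        by_cases hkU : k = U
        · exfalso
          apply hkR
          rw [hkU]
          have := mem_acc.1 hUA
          cases this with
          | base => exact .base _ (Finset.mem_erase.2 ⟨fun h => hwU h.symm, haC⟩)
          | step _ _ i hi hm hi2 =>
            exact .step _ U i (Finset.mem_erase.2 ⟨fun h => hwU h.symm, hi⟩) hm (hS i hi2)
        · by_contra hkT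
          exact hkR ((hS k (S1 k hkA hkU hkT)).mono (Finset.erase_subset _ _))
      · exact ((memT w w).1 (h hw)).1.1 rfl
    exact absurd (Finset.card_lt_card hsub) (by omega)
  · intro h; exact ((memT U U).1 h).1.1 rfl
  · intro j hj k hk hkT hkU hm
    obtain ⟨⟨hjU, hjA⟩, hjR⟩ := (memT U j).1 hj
    exact hjR ((S1 k hk hkU hkT).cons (Finset.mem_erase.2 ⟨hjU, acc_subset hjA⟩) hm)

end KrHS

namespace KrHS
open scoped Classical

variable {V : Type*} [DecidableEq V]
variable {H : SimpleGraph V} {W : Finset V} {C : Finset ℕ} {s : ℕ} {f : V → ℕ} {a b : ℕ}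

theorem nb_double (S T : Finset V) :
    ∑ x ∈ S, (nb H x T).card = ∑ y ∈ T, (nb H y S).card := by
  have h := Finset.sum_card_bipartiteAbove_eq_sum_card_bipartiteBelow (s := S) (t := T)
    (fun x y => H.Adj x y)
  simp only [Finset.bipartiteAbove, Finset.bipartiteBelow] at h
  simp only [nb]
  rw [h]
  refine Finset.sum_congr rfl fun y _ => ?_
  congr 1
  ext x
  simp [H.adj_comm]

theorem acc_card_add : (acc H W C f a).card + (C \ acc H W C f a).card = C.card := by
  rw [Finset.card_sdiff_of_subset acc_subset]
  have := Finset.card_le_card (acc_subset (H := H) (W := W) (C := C) (f := f) (a := a))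
  omega

theorem acc_ne (hN : Near H W C s f a b) (hb : b ∉ acc H W C f a)
    (hdeg : ∀ x ∈ W, (nb H x W).card < C.card) : ∃ i ∈ acc H W C f a, i ≠ a := by
  by_contra hcon
  push Not at hcon
  have haA : a ∈ acc H W C f a := mem_acc.2 (.base _ hN.ha)
  have hA : acc H W C f a = {a} := by
    ext i
    rw [Finset.mem_singleton]
    exact ⟨hcon i, fun h => h ▸ haA⟩
  have h1 := bad_card hN hb
  have h2 := acc_card_add (H := H) (W := W) (C := C) (f := f) (a := a)
  have h3 : (bad H W C f a).card ≤ ∑ y ∈ bad H W C f a, (nb H y (cls W f a)).card := by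
    rw [Finset.card_eq_sum_ones]
    exact Finset.sum_le_sum fun y hy => bad_nb hN.mem hy haA
  rw [nb_double] at h3
  have h4 : ∑ x ∈ cls W f a, (nb H x (bad H W C f a)).card ≤
      ∑ x ∈ cls W f a, (C \ acc H W C f a).card := by
    refine Finset.sum_le_sum fun x hx => ?_
    have h5 := hdeg x (mem_cls.1 hx).1
    have h6 := nb_total (H := H) (a := a) hN.mem x
    rw [hA, Finset.card_singleton] at h2
    rw [hA] at h6 ⊢
    omega
  rw [Finset.sum_const, smul_eq_mul] at h4
  have h5 := hN.ca
  have h6 : (cls W f a).card * (C \ acc H W C f a).card ≤ s * (C \ acc H W C f a).card :=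
    Nat.mul_le_mul_right _ (by omega)
  rw [mul_comm s] at h6
  omega

/-- independent set -/
def Indep (H : SimpleGraph V) (I : Finset V) : Prop := ∀ x ∈ I, ∀ y ∈ I, ¬ H.Adj x y

theorem comb (hN : Near H W C s f a b) (hb : b ∉ acc H W C f a)
    (hdeg : ∀ x ∈ W, (nb H x W).card < C.card)
    (IH : ∀ C' : Finset ℕ, C'.card < C.card → HSfor V s C') :
    (∃ f', Equit H W C s f') ∨
      ∃ F b', Near H W C s F a b' ∧ acc H W C f a ⊂ acc H W C F a := by
  obtain ⟨A', hA'A, hA'ne, haA', hterm, U, hUA, hUA', hmv⟩ :=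
    terminal (H := H) (W := W) (f := f) hN.ha (acc_ne hN hb hdeg)
  by_cases hc1 : ∃ w ∈ A', ∃ z ∈ W, f z = w ∧ ∃ y ∈ bad H W C f a, Solo H W f y z ∧
      ∃ j ∈ acc H W C f a, j ≠ w ∧ ∀ u ∈ W, f u = j → ¬ H.Adj z u
  · left
    obtain ⟨w, hw, z, hz, hzw, y, hy, hsolo, j, hj, hjw, hzj⟩ := hc1
    exact case1 hN hb hdeg IH (hA'A hw) (fun h => haA' (h ▸ hw)) (hterm w hw j hj hjw) hz hzw hy
      hsolo hzj
  right
  push Not at hc1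
  have hAC := acc_card_add (H := H) (W := W) (C := C) (f := f) (a := a)
  have hBc := bad_card hN hb
  have hclsA' : ∀ w ∈ A', (cls W f w).card = s := fun w hw =>
    hN.co w (acc_subset (hA'A hw)) (fun h => haA' (h ▸ hw)) (fun h => hb (h ▸ hA'A hw))
  have htm : A'.card + (acc H W C f a \ A').card = (acc H W C f a).card := by
    rw [Finset.card_sdiff_of_subset hA'A]
    have := Finset.card_le_card hA'A
    omega
  -- Lemma 2
  have L2 : (C \ acc H W C f a).card < A'.card := by
    obtain ⟨w, hw⟩ := hA'ne
    set S := (cls W f w).filter (fun x => ∃ y ∈ bad H W C f a, Solo H W f y x) with hS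
    set D := (cls W f w).filter (fun x => ¬ ∃ y ∈ bad H W C f a, Solo H W f y x) with hD
    have hSD : S.card + D.card = s := by
      rw [← hclsA' w hw]
      exact Finset.card_filter_add_card_filter_not _
    have dS : ∀ z ∈ S, (nb H z (bad H W C f a)).card ≤ (C \ acc H W C f a).card := by
      intro z hz
      obtain ⟨h1, y, hy, hsolo⟩ := Finset.mem_filter.1 hz
      obtain ⟨hzW, hzw⟩ := mem_cls.1 h1
      have h2 : ((acc H W C f a).erase w).card ≤ ∑ l ∈ acc H W C f a, (nb H z (cls W f l)).card := by
        rw [Finset.card_eq_sum_ones]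
        refine le_trans (Finset.sum_le_sum fun l hl => ?_)
          (Finset.sum_le_sum_of_subset (Finset.erase_subset w _))
        obtain ⟨h3, h4⟩ := Finset.mem_erase.1 hl
        obtain ⟨u, hu, hul, hzu⟩ := hc1 w hw z hzW hzw y hy hsolo l h4 h3
        exact Finset.card_pos.2 ⟨u, mem_nb.2 ⟨mem_cls.2 ⟨hu, hul⟩, hzu⟩⟩
      have h3 := Finset.card_erase_add_one (hA'A hw)
      have h4 := nb_total (H := H) (a := a) hN.mem z
      have h5 := hdeg z hzW
      omega
    have dD : ∀ z ∈ D, (nb H z (bad H W C f a)).card ≤ A'.card + (C \ acc H W C f a).card := by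
      intro z hz
      obtain ⟨h1, _⟩ := Finset.mem_filter.1 hz
      obtain ⟨hzW, hzw⟩ := mem_cls.1 h1
      have h2 : ((acc H W C f a \ A').erase U).card ≤
          ∑ l ∈ acc H W C f a, (nb H z (cls W f l)).card := by
        rw [Finset.card_eq_sum_ones]
        refine le_trans (Finset.sum_le_sum fun l hl => ?_)
          (Finset.sum_le_sum_of_subset ((Finset.erase_subset U _).trans Finset.sdiff_subset))
        obtain ⟨h3, h4⟩ := Finset.mem_erase.1 hl
        obtain ⟨h5, h6⟩ := Finset.mem_sdiff.1 h4
        by_contra hcon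
        apply hmv w hw l h5 h6 h3
        refine ⟨z, hzW, hzw, fun u hu hul hzu => hcon ?_⟩
        exact Finset.card_pos.2 ⟨u, mem_nb.2 ⟨mem_cls.2 ⟨hu, hul⟩, hzu⟩⟩
      have h3 := Finset.card_erase_add_one (Finset.mem_sdiff.2 ⟨hUA, hUA'⟩)
      have h4 := nb_total (H := H) (a := a) hN.mem z
      have h5 := hdeg z hzW
      omega
    have dB : ∀ y ∈ bad H W C f a, 2 ≤ 2 * (nb H y S).card + (nb H y D).card := by
      intro y hy
      have h1 := bad_nb hN.mem hy (hA'A hw)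
      have h2 : (nb H y (cls W f w)).card = (nb H y S).card + (nb H y D).card := by
        rw [← Finset.card_filter_add_card_filter_not (s := nb H y (cls W f w))
          (fun x => ∃ y ∈ bad H W C f a, Solo H W f y x)]
        congr 2
        · ext x; simp only [mem_nb, hS, Finset.mem_filter]; tauto
        · ext x; simp only [mem_nb, hD, Finset.mem_filter]; tauto
      by_contra hcon
      have h3 : (nb H y S).card = 0 := by omega
      have h4 : (nb H y (cls W f w)).card = 1 := by omega
      obtain ⟨x, hx⟩ := Finset.card_eq_one.1 h4
      have hxm : x ∈ nb H y (cls W f w) := by rw [hx]; simp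
      obtain ⟨hxc, hyx⟩ := mem_nb.1 hxm
      have : x ∈ nb H y S := by
        refine mem_nb.2 ⟨Finset.mem_filter.2 ⟨hxc, y, hy, hyx, ?_⟩, hyx⟩
        intro u hu hux hyu
        have : u ∈ nb H y (cls W f w) :=
          mem_nb.2 ⟨mem_cls.2 ⟨hu, hux.trans (mem_cls.1 hxc).2⟩, hyu⟩
        rw [hx] at this
        exact Finset.mem_singleton.1 this
      rw [Finset.card_eq_zero.1 h3] at this
      exact Finset.notMem_empty _ this
    have h1 := Finset.sum_le_sum dB
    rw [Finset.sum_add_distrib, ← Finset.mul_sum, nb_double _ S, nb_double _ D, Finset.sum_const,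
      smul_eq_mul] at h1
    have h2 := Finset.sum_le_sum dS
    have h3 := Finset.sum_le_sum dD
    rw [Finset.sum_const, smul_eq_mul] at h2 h3
    by_contra hcon
    push Not at hcon
    have h4 : D.card * (A'.card + (C \ acc H W C f a).card) ≤
      D.card * (2 * (C \ acc H W C f a).card) := Nat.mul_le_mul_left _ (by omega)
    rw [hBc, ← hSD] at h1
    nlinarith
  -- Lemma 3
  set Sy : V → Finset V := fun y => W.filter (fun z => f z ∈ A' ∧ Solo H W f y z) with hSy
  have L3 : ∀ y ∈ bad H W C f a, A'.card + 1 + (nb H y (bad H W C f a)).card ≤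
      (Sy y).card + (C \ acc H W C f a).card := by
    intro y hy
    set σ := A'.filter (fun w => (nb H y (cls W f w)).card = 1) with hσ
    have h1 : σ.card ≤ (Sy y).card := by
      refine le_trans (Finset.card_le_card ?_) (Finset.card_image_le (f := f))
      intro w hw
      obtain ⟨hwA, hw1⟩ := Finset.mem_filter.1 hw
      obtain ⟨x, hx⟩ := Finset.card_eq_one.1 hw1
      have hxm : x ∈ nb H y (cls W f w) := by rw [hx]; simp
      obtain ⟨hxc, hyx⟩ := mem_nb.1 hxm
      obtain ⟨hxW, hxw⟩ := mem_cls.1 hxc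
      refine Finset.mem_image.2 ⟨x, Finset.mem_filter.2 ⟨hxW, hxw ▸ hwA, hyx, ?_⟩, hxw⟩
      intro u hu hux hyu
      have : u ∈ nb H y (cls W f w) := mem_nb.2 ⟨mem_cls.2 ⟨hu, hux.trans hxw⟩, hyu⟩
      rw [hx] at this
      exact Finset.mem_singleton.1 this
    have h2 : 2 * A'.card ≤ ∑ l ∈ A', (nb H y (cls W f l)).card + σ.card := by
      rw [hσ, Finset.card_filter, ← Finset.sum_add_distrib, mul_comm, ← smul_eq_mul,
        ← Finset.sum_const]
      refine Finset.sum_le_sum fun l hl => ?_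
      have := bad_nb hN.mem hy (hA'A hl)
      split_ifs <;> omega
    have h3 : (acc H W C f a \ A').card ≤ ∑ l ∈ acc H W C f a \ A', (nb H y (cls W f l)).card := by
      rw [Finset.card_eq_sum_ones]
      exact Finset.sum_le_sum fun l hl => bad_nb hN.mem hy (Finset.mem_sdiff.1 hl).1
    have h4 := nb_total (H := H) (a := a) hN.mem y
    rw [← Finset.sum_sdiff hA'A] at h4
    have h5 := hdeg y (mem_bad.1 hy).1
    omega
  -- independent set
  obtain ⟨I, hI, hImax⟩ := Finset.exists_max_image
    ((bad H W C f a).powerset.filter (fun I => Indep H I)) Finset.card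
    ⟨∅, Finset.mem_filter.2 ⟨by simp, fun x hx => absurd hx (by simp)⟩⟩
  obtain ⟨hIB, hIind⟩ := Finset.mem_filter.1 hI
  rw [Finset.mem_powerset] at hIB
  have hcov : bad H W C f a ⊆ I.biUnion (fun y => insert y (nb H y (bad H W C f a))) := by
    intro x hx
    rw [Finset.mem_biUnion]
    by_contra hcon
    push Not at hcon
    have hxI : x ∉ I := fun h => hcon x h (Finset.mem_insert_self _ _)
    have hxadj : ∀ y ∈ I, ¬ H.Adj y x := fun y hy h =>
      hcon y hy (Finset.mem_insert_of_mem (mem_nb.2 ⟨hx, h⟩))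
    have := hImax (insert x I) (by
      rw [Finset.mem_filter, Finset.mem_powerset]
      refine ⟨Finset.insert_subset hx hIB, ?_⟩
      intro u hu v hv
      rw [Finset.mem_insert] at hu hv
      rcases hu with rfl | hu <;> rcases hv with rfl | hv
      · exact H.irrefl
      · exact fun h => hxadj v hv h.symm
      · exact hxadj u hu
      · exact hIind u hu v hv)
    rw [Finset.card_insert_of_notMem hxI] at this
    omega
  have hcov2 : (bad H W C f a).card ≤ ∑ y ∈ I, ((nb H y (bad H W C f a)).card + 1) := by
    refine (Finset.card_le_card hcov).trans (Finset.card_biUnion_le.trans ?_)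
    exact Finset.sum_le_sum fun y _ => Finset.card_insert_le _ _
  have hIs : s < I.card := by
    have : ∑ y ∈ I, ((nb H y (bad H W C f a)).card + 1) ≤ ∑ y ∈ I, (C \ acc H W C f a).card :=
      Finset.sum_le_sum fun y hy => bad_deg hN.mem hdeg (hIB hy)
    rw [Finset.sum_const, smul_eq_mul] at this
    by_contra hcon
    push Not at hcon
    have h6 := Nat.mul_le_mul_right (C \ acc H W C f a).card hcon
    rw [mul_comm s] at h6
    omega
  have hsum : A'.card * I.card + (bad H W C f a).card ≤
      ∑ y ∈ I, (Sy y).card + (C \ acc H W C f a).card * I.card := by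
    have h1 : ∑ y ∈ I, (A'.card + ((nb H y (bad H W C f a)).card + 1)) ≤
        ∑ y ∈ I, ((Sy y).card + (C \ acc H W C f a).card) := by
      refine Finset.sum_le_sum fun y hy => ?_
      have := L3 y (hIB hy)
      omega
    rw [Finset.sum_add_distrib, Finset.sum_add_distrib (f := fun y => (Sy y).card), Finset.sum_const,
      Finset.sum_const, smul_eq_mul, smul_eq_mul, mul_comm I.card, mul_comm I.card] at h1
    omega
  have hbig : A'.card * s < ∑ y ∈ I, (Sy y).card := by
    obtain ⟨d, hd⟩ := Nat.exists_eq_add_of_lt L2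
    obtain ⟨k, hk⟩ := Nat.exists_eq_add_of_lt hIs
    rw [hd, hBc] at hsum
    rw [hd]
    rw [hk] at hsum
    nlinarith
  obtain ⟨y, hy, y₂, hy₂, hyy, z, hz, hz₂⟩ : ∃ y ∈ I, ∃ y₂ ∈ I, y ≠ y₂ ∧ ∃ z, z ∈ Sy y ∧ z ∈ Sy y₂ := by
    by_contra hcon
    push Not at hcon
    have h1 := Finset.card_biUnion (s := I) (t := Sy) (fun x hx y hy hxy => by
      show Disjoint (Sy x) (Sy y)
      rw [Finset.disjoint_left]
      exact fun z hz hz2 => hcon x hx y hy hxy z hz hz2)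
    have h2 : (I.biUnion Sy).card ≤ (W.filter (fun x => f x ∈ A')).card := by
      apply Finset.card_le_card
      intro z hz
      obtain ⟨y, _, hz⟩ := Finset.mem_biUnion.1 hz
      obtain ⟨h1, h2, _⟩ := Finset.mem_filter.1 hz
      exact Finset.mem_filter.2 ⟨h1, h2⟩
    rw [sum_cls, Finset.sum_congr rfl hclsA', Finset.sum_const, smul_eq_mul] at h2
    omega
  obtain ⟨hzW, hzA', hsolo⟩ := Finset.mem_filter.1 hz
  obtain ⟨_, _, hsolo₂⟩ := Finset.mem_filter.1 hz₂
  exact case2 hN hb hdeg IH (hA'A hzA') (fun h => haA' (h ▸ hzA')) (hterm _ hzA') hzW rfl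
    (hIB hy) hsolo (hIB hy₂) hsolo₂ hyy (hIind y hy y₂ hy₂)
    (fun j hj hjw => hc1 _ hzA' z hzW rfl y (hIB hy) hsolo j hj hjw)

theorem near (hdeg : ∀ x ∈ W, (nb H x W).card < C.card)
    (IH : ∀ C' : Finset ℕ, C'.card < C.card → HSfor V s C') :
    ∀ (k : ℕ) (f : V → ℕ) (b : ℕ), (C \ acc H W C f a).card = k → Near H W C s f a b →
      ∃ f', Equit H W C s f' := by
  intro k
  induction k using Nat.strong_induction_on with
  | _ k ih =>
    intro f b hk hN
    by_cases hb : b ∈ acc H W C f a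
    · exact of_accessible hN hb
    · rcases comb hN hb hdeg IH with h | ⟨F, b', hF, hss⟩
      · exact h
      · refine ih _ ?_ F b' rfl hF
        rw [← hk]
        have h1 := acc_card_add (H := H) (W := W) (C := C) (f := f) (a := a)
        have h2 := acc_card_add (H := H) (W := W) (C := C) (f := F) (a := a)
        have h3 := Finset.card_lt_card hss
        omega

theorem equipart (s : ℕ) (C : Finset ℕ) : ∀ W : Finset V, W.card = C.card * s →
    ∃ f : V → ℕ, (∀ x ∈ W, f x ∈ C) ∧ ∀ i ∈ C, (cls W f i).card = s := by
  induction C using Finset.induction_on with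
  | empty =>
    intro W hW
    simp at hW
    exact ⟨fun _ => 0, by simp [hW], by simp⟩
  | insert c C hc ih =>
    intro W hW
    rw [Finset.card_insert_of_notMem hc, add_mul, one_mul] at hW
    obtain ⟨X, hXW, hX⟩ := Finset.exists_subset_card_eq (s := W) (n := s) (by omega)
    obtain ⟨f, hf1, hf2⟩ := ih (W \ X) (by rw [Finset.card_sdiff_of_subset hXW]; omega)
    refine ⟨fun x => if x ∈ X then c else f x, ?_, ?_⟩
    · intro x hx
      by_cases h : x ∈ X
      · simp [h]
      · simp only [h, if_false]
        exact Finset.mem_insert_of_mem (hf1 x (Finset.mem_sdiff.2 ⟨hx, h⟩))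
    · intro i hi
      rcases Finset.mem_insert.1 hi with rfl | hi
      · rw [← hX]
        congr 1
        ext x
        rw [mem_cls]
        by_cases h : x ∈ X
        · simp [h, hXW h]
        · simp only [h, if_false, iff_false, not_and]
          intro hx hfx
          exact hc (hfx ▸ hf1 x (Finset.mem_sdiff.2 ⟨hx, h⟩))
      · rw [← hf2 i hi]
        congr 1
        ext x
        rw [mem_cls, mem_cls, Finset.mem_sdiff]
        by_cases h : x ∈ X
        · simp only [h, if_true, not_true_eq_false, and_false, false_and, iff_false, not_and]
          rintro _ rfl
          exact hc hi
        · simp [h]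

/-- keep only edges inside `P` -/
def restr (H : SimpleGraph V) (P : Finset V) : SimpleGraph V where
  Adj x y := H.Adj x y ∧ x ∈ P ∧ y ∈ P
  symm := ⟨fun _ _ h => ⟨h.1.symm, h.2.2, h.2.1⟩⟩
  loopless := ⟨fun _ h => H.irrefl h.1⟩

theorem hs (s : ℕ) (C : Finset ℕ) : HSfor V s C := by
  induction hn : C.card using Nat.strong_induction_on generalizing C with
  | _ n ih =>
  have IH : ∀ C' : Finset ℕ, C'.card < C.card → HSfor V s C' := fun C' h => ih _ (hn ▸ h) C' rfl
  intro H W hW hdeg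
  have key : ∀ P : Finset V, P ⊆ W → ∃ f, Equit (restr H P) W C s f := by
    intro P
    induction P using Finset.induction_on with
    | empty =>
      intro _
      obtain ⟨f, h1, h2⟩ := equipart s C W hW
      exact ⟨f, h1, fun x _ y _ h => by simp [restr] at h, h2⟩
    | insert x P hxP ihP =>
      intro hP
      have hxW := hP (Finset.mem_insert_self x P)
      obtain ⟨f, f1, f2, f3⟩ := ihP ((Finset.subset_insert x P).trans hP)
      have hdeg' : ∀ y ∈ W, (nb (restr H (insert x P)) y W).card < C.card := by
        intro y hy
        refine lt_of_le_of_lt (Finset.card_le_card ?_) (hdeg y hy)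
        intro u hu
        rw [mem_nb] at hu ⊢
        exact ⟨hu.1, hu.2.1⟩
      -- a color free at x
      obtain ⟨l, hl, hlx⟩ : ∃ l ∈ C, ∀ u ∈ W, f u = l → ¬ H.Adj x u := by
        by_contra hcon
        push Not at hcon
        have : C.card ≤ (nb H x W).card := by
          have hsub : C ⊆ (nb H x W).image f := by
            intro l hl
            obtain ⟨u, hu, hul, hxu⟩ := hcon l hl
            exact Finset.mem_image.2 ⟨u, mem_nb.2 ⟨hu, hxu⟩, hul⟩
          exact (Finset.card_le_card hsub).trans Finset.card_image_le
        have := hdeg x hxW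
        omega
      have proper : ∀ g : V → ℕ, g x = l → (∀ u, u ≠ x → g u = f u) →
          ProperOn (restr H (insert x P)) W g := by
        intro g g1 g2 u hu v hv huv
        obtain ⟨h1, h2, h3⟩ := huv
        by_cases hux : u = x
        · have hvx : v ≠ x := by rintro rfl; rw [hux] at h1; exact H.irrefl h1
          rw [hux, g1, g2 v hvx]
          intro h
          exact hlx v hv h.symm (hux ▸ h1)
        · by_cases hvx : v = x
          · rw [hvx, g1, g2 u hux]
            intro h
            exact hlx u hu h (hvx ▸ h1.symm)
          · rw [g2 u hux, g2 v hvx]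
            exact f2 u hu v hv ⟨h1, Finset.mem_of_mem_insert_of_ne h2 hux,
              Finset.mem_of_mem_insert_of_ne h3 hvx⟩
      by_cases hfl : f x = l
      · exact ⟨f, f1, proper f hfl (fun _ _ => rfl), f3⟩
      · set g : V → ℕ := fun u => if u = x then l else f u with hg
        have g1 : g x = l := by simp [hg]
        have g2 : ∀ u, u ≠ x → g u = f u := by intro u hu; simp [hg, hu]
        have hca : cls W g (f x) = (cls W f (f x)).erase x := by
          ext u
          rw [Finset.mem_erase, mem_cls, mem_cls]
          by_cases h : u = x
          · subst h; simp [g1, Ne.symm hfl]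
          · simp [g2 u h, h]
        have hcb : cls W g l = insert x (cls W f l) := by
          ext u
          rw [Finset.mem_insert, mem_cls, mem_cls]
          by_cases h : u = x
          · subst h; simp [g1, hxW]
          · simp [g2 u h, h]
        have hN : Near (restr H (insert x P)) W C s g (f x) l := by
          refine ⟨?_, proper g g1 g2, f1 x hxW, hl, hfl, ?_, ?_, ?_⟩
          · intro u hu
            by_cases h : u = x
            · rw [h, g1]; exact hl
            · rw [g2 u h]; exact f1 u hu
          · rw [hca, Finset.card_erase_add_one (mem_cls.2 ⟨hxW, rfl⟩), f3 _ (f1 x hxW)]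
          · rw [hcb, Finset.card_insert_of_notMem (by simp [mem_cls, hfl]), f3 l hl]
          · intro i hi h1 h2
            rw [← f3 i hi]
            congr 1
            ext u
            rw [mem_cls, mem_cls]
            by_cases h : u = x
            · subst h; simp [g1, Ne.symm h1, Ne.symm h2]
            · simp [g2 u h]
        exact near hdeg' IH _ g l rfl hN
  obtain ⟨f, f1, f2, f3⟩ := key W subset_rfl
  exact ⟨f, f1, fun x hx y hy h => f2 x hx y hy ⟨h, hx, hy⟩, f3⟩

end KrHS

namespace KrCore
open scoped Classical

variable {V : Type*} [DecidableEq V] {q : ℕ}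

/-- number of edges of color `c` inside `K` -/
def ec (f : Sym2 V → Fin q) (c : Fin q) (K : Finset V) : ℕ :=
  (K.sym2.filter fun e => ¬ e.IsDiag ∧ f e = c).card

/-- number of edges of color `c` from `x` to `Q` -/
def dc (f : Sym2 V → Fin q) (c : Fin q) (x : V) (Q : Finset V) : ℕ :=
  (Q.filter fun y => f s(x, y) = c).card

theorem count_eq (f : Sym2 V → Fin q) (T : Finset (Finset V)) (c : Fin q) :
    tilingColorCount f T c = ∑ K ∈ T, ec f c K := rfl

theorem ec_insert (f : Sym2 V → Fin q) (c : Fin q) {x : V} {Q : Finset V} (hx : x ∉ Q) :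
    ec f c (insert x Q) = ec f c Q + dc f c x Q := by
  have h : (insert x Q).sym2.filter (fun e => ¬ e.IsDiag ∧ f e = c) =
      (Q.sym2.filter fun e => ¬ e.IsDiag ∧ f e = c) ∪
        (Q.filter fun y => f s(x, y) = c).image (fun y => s(x, y)) := by
    ext e
    induction e using Sym2.inductionOn with
    | hf u v =>
      simp only [Finset.mem_filter, Finset.mk_mem_sym2_iff, Finset.mem_insert, Sym2.mk_isDiag_iff,
        Finset.mem_union, Finset.mem_image, Sym2.eq_iff]
      constructor
      · rintro ⟨⟨h1, h2⟩, h3, h4⟩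
        rcases h1 with rfl | h1 <;> rcases h2 with rfl | h2
        · exact absurd rfl h3
        · right; exact ⟨v, ⟨h2, h4⟩, Or.inl ⟨rfl, rfl⟩⟩
        · right; exact ⟨u, ⟨h1, by rw [Sym2.eq_swap]; exact h4⟩, Or.inr ⟨rfl, rfl⟩⟩
        · left; exact ⟨⟨h1, h2⟩, h3, h4⟩
      · rintro (⟨⟨h1, h2⟩, h3, h4⟩ | ⟨y, ⟨h1, h2⟩, ⟨rfl, rfl⟩ | ⟨rfl, rfl⟩⟩)
        · exact ⟨⟨Or.inr h1, Or.inr h2⟩, h3, h4⟩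
        · exact ⟨⟨Or.inl rfl, Or.inr h1⟩, fun h => hx (h ▸ h1), h2⟩
        · exact ⟨⟨Or.inr h1, Or.inl rfl⟩, fun h => hx (h ▸ h1), by rw [Sym2.eq_swap]; exact h2⟩
  rw [ec, h, Finset.card_union_of_disjoint, Finset.card_image_of_injective]
  · rfl
  · intro u v huv
    rcases Sym2.eq_iff.1 huv with ⟨_, h⟩ | ⟨h1, h2⟩
    · exact h
    · exact h2.trans h1
  · rw [Finset.disjoint_left]
    intro e h1 h2
    obtain ⟨y, hy, rfl⟩ := Finset.mem_image.1 h2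
    exact hx (Finset.mk_mem_sym2_iff.1 (Finset.mem_filter.1 h1).1).1

theorem dc_insert (f : Sym2 V → Fin q) (c : Fin q) {x y : V} {Q : Finset V} (hy : y ∉ Q) :
    dc f c x (insert y Q) = dc f c x Q + if f s(x, y) = c then 1 else 0 := by
  unfold dc
  rw [Finset.filter_insert]
  split_ifs with h
  · rw [Finset.card_insert_of_notMem (by simp [hy])]
  · rfl

theorem dc_eq_sum (f : Sym2 V → Fin q) (c : Fin q) (x : V) (Q : Finset V) :
    dc f c x Q = ∑ y ∈ Q, if f s(x, y) = c then 1 else 0 := by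
  rw [dc, Finset.card_filter]

theorem dc_le (f : Sym2 V → Fin q) (c : Fin q) (x : V) (Q : Finset V) : dc f c x Q ≤ Q.card :=
  Finset.card_filter_le _ _

theorem ec_mono (f : Sym2 V → Fin q) (c : Fin q) {K L : Finset V} (h : K ⊆ L) :
    ec f c K ≤ ec f c L := by
  apply Finset.card_le_card
  apply Finset.filter_subset_filter
  exact Finset.sym2_mono h

theorem ec_erase (f : Sym2 V → Fin q) (c : Fin q) {x : V} {K : Finset V} (hx : x ∈ K) :
    ec f c K = ec f c (K.erase x) + dc f c x (K.erase x) := by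
  conv_lhs => rw [← Finset.insert_erase hx]
  exact ec_insert f c (by simp)

theorem handshake (f : Sym2 V → Fin q) (c : Fin q) (K : Finset V) :
    ∑ y ∈ K, dc f c y (K.erase y) = 2 * ec f c K := by
  induction K using Finset.induction_on with
  | empty => simp [ec]
  | insert x Q hx ih =>
    rw [Finset.sum_insert hx, Finset.erase_insert hx, ec_insert f c hx, mul_add, ← ih]
    have : ∀ y ∈ Q, dc f c y ((insert x Q).erase y) =
        dc f c y (Q.erase y) + if f s(x, y) = c then 1 else 0 := by
      intro y hy
      have hxy : x ≠ y := by rintro rfl; exact hx hy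
      rw [Finset.erase_insert_of_ne hxy, dc_insert f c (by simp [hx]), Sym2.eq_swap]
    rw [Finset.sum_congr rfl this, Finset.sum_add_distrib, ← dc_eq_sum]
    ring

theorem ec_total (f : Sym2 V → Fin q) (K : Finset V) :
    2 * ∑ c, ec f c K + K.card = K.card * K.card := by
  induction K using Finset.induction_on with
  | empty => simp [ec]
  | insert x Q hx ih =>
    rw [Finset.sum_congr rfl (fun c _ => ec_insert f c hx), Finset.sum_add_distrib,
      Finset.card_insert_of_notMem hx]
    have : ∑ c, dc f c x Q = Q.card := by
      simp only [dc]
      exact (Finset.card_eq_sum_card_fiberwise (f := fun y => f s(x, y)) (t := univ)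
        (fun _ _ => by simp)).symm
    rw [this]
    nlinarith

theorem edge_total (f : Sym2 V → Fin q) (T : Finset (Finset V)) :
    tilingEdgeCount T = ∑ c, tilingColorCount f T c := by
  unfold tilingEdgeCount tilingColorCount
  rw [Finset.sum_comm]
  refine Finset.sum_congr rfl fun K _ => ?_
  rw [Finset.card_eq_sum_card_fiberwise (f := f) (t := univ) (fun _ _ => by simp)]
  refine Finset.sum_congr rfl fun c _ => ?_
  rw [Finset.filter_filter]

/-- non-neighbours in `W` -/
noncomputable def nonb (G : SimpleGraph V) (x : V) (W : Finset V) : Finset V :=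
  W.filter (fun y => ¬ G.Adj x y)

theorem mem_nonb {G : SimpleGraph V} {x y : V} {W : Finset V} :
    y ∈ nonb G x W ↔ y ∈ W ∧ ¬ G.Adj x y := by simp [nonb]

/-- every vertex of `W` has at most `D` nonneighbours in `W` -/
def LowD (G : SimpleGraph V) (W : Finset V) (D : ℕ) : Prop := ∀ x ∈ W, (nonb G x W).card ≤ D

theorem LowD.mono {G : SimpleGraph V} {W W' : Finset V} {D D' : ℕ} (h : LowD G W D) (hW : W' ⊆ W)
    (hD : D ≤ D') : LowD G W' D' := fun x hx =>
  (Finset.card_le_card (Finset.filter_subset_filter _ hW)).trans ((h x (hW hx)).trans hD)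

theorem tile {G : SimpleGraph V} {W : Finset V} {r D : ℕ} (hW : W.card = D * r)
    (hD : LowD G W D) : ∃ T, IsKrTilingOn G r T W := by
  obtain ⟨f, f1, f2, f3⟩ := KrHS.hs (V := V) r (Finset.range D) Gᶜ W (by simpa using hW) (by
    intro x hx
    rw [Finset.card_range]
    refine lt_of_lt_of_le (Finset.card_lt_card ⟨?_, ?_⟩) (hD x hx)
    · intro y hy
      rw [KrHS.mem_nb, SimpleGraph.compl_adj] at hy
      exact mem_nonb.2 ⟨hy.1, hy.2.2⟩
    · intro h
      have := h (mem_nonb.2 ⟨hx, G.irrefl⟩)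
      rw [KrHS.mem_nb] at this
      exact (Gᶜ).irrefl this.2)
  refine ⟨(Finset.range D).image (KrHS.cls W f), ?_, ?_, ?_⟩
  · intro K hK
    obtain ⟨i, hi, rfl⟩ := Finset.mem_image.1 hK
    refine ⟨?_, f3 i hi⟩
    intro x hx y hy hxy
    obtain ⟨h1, h2⟩ := KrHS.mem_cls.1 (Finset.mem_coe.1 hx)
    obtain ⟨h3, h4⟩ := KrHS.mem_cls.1 (Finset.mem_coe.1 hy)
    by_contra hcon
    exact f2 x h1 y h3 ((SimpleGraph.compl_adj _ _ _).2 ⟨hxy, hcon⟩) (h2.trans h4.symm)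
  · intro K hK K' hK' hne
    obtain ⟨i, hi, rfl⟩ := Finset.mem_image.1 hK
    obtain ⟨j, hj, rfl⟩ := Finset.mem_image.1 hK'
    rw [Finset.disjoint_left]
    intro x hx hx'
    have h1 := (KrHS.mem_cls.1 hx).2
    have h2 := (KrHS.mem_cls.1 hx').2
    exact hne (by rw [← h1, h2])
  · ext x
    simp only [Finset.mem_biUnion, Finset.mem_image, id]
    constructor
    · rintro ⟨_, ⟨i, _, rfl⟩, hx⟩
      exact (KrHS.mem_cls.1 hx).1
    · intro hx
      exact ⟨_, ⟨f x, f1 x hx, rfl⟩, KrHS.mem_cls.2 ⟨hx, rfl⟩⟩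

theorem tiling_single {G : SimpleGraph V} {r : ℕ} {K : Finset V} (hK : G.IsNClique r K) :
    IsKrTilingOn G r {K} K := by
  refine ⟨by simpa using hK, ?_, by simp⟩
  intro A hA B hB h
  rw [Finset.mem_singleton] at hA hB
  exact absurd (hA.trans hB.symm) h

theorem tiling_empty {G : SimpleGraph V} {r : ℕ} : IsKrTilingOn G r ∅ ∅ := by
  refine ⟨by simp, by simp, by simp⟩

theorem tiling_sub {G : SimpleGraph V} {r : ℕ} {T : Finset (Finset V)} {W : Finset V}
    (h : IsKrTilingOn G r T W) {K : Finset V} (hK : K ∈ T) : K ⊆ W := by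
  rw [← h.2.2]
  exact Finset.subset_biUnion_of_mem id hK

theorem tiling_union {G : SimpleGraph V} {r : ℕ} (hr : 0 < r) {T₁ T₂ : Finset (Finset V)}
    {W₁ W₂ : Finset V} (h₁ : IsKrTilingOn G r T₁ W₁) (h₂ : IsKrTilingOn G r T₂ W₂)
    (hd : Disjoint W₁ W₂) : IsKrTilingOn G r (T₁ ∪ T₂) (W₁ ∪ W₂) ∧ Disjoint T₁ T₂ := by
  have hx : ∀ K₁ ∈ T₁, ∀ K₂ ∈ T₂, Disjoint K₁ K₂ := fun K₁ k₁ K₂ k₂ =>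
    Finset.disjoint_of_subset_left (tiling_sub h₁ k₁)
      (Finset.disjoint_of_subset_right (tiling_sub h₂ k₂) hd)
  refine ⟨⟨?_, ?_, ?_⟩, ?_⟩
  · intro K hK
    rcases Finset.mem_union.1 hK with h | h
    · exact h₁.1 K h
    · exact h₂.1 K h
  · intro A hA B hB hAB
    rcases Finset.mem_union.1 hA with ha | ha <;> rcases Finset.mem_union.1 hB with hb | hb
    · exact h₁.2.1 A ha B hb hAB
    · exact hx A ha B hb
    · exact (hx B hb A ha).symm
    · exact h₂.2.1 A ha B hb hAB
  · rw [Finset.union_biUnion, h₁.2.2, h₂.2.2]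
  · rw [Finset.disjoint_left]
    intro K k₁ k₂
    have h1 := hx K k₁ K k₂
    rw [Finset.disjoint_self_iff_empty] at h1
    have := (h₁.1 K k₁).card_eq
    rw [h1, Finset.card_empty] at this
    omega

theorem count_union (f : Sym2 V → Fin q) (c : Fin q) {T₁ T₂ : Finset (Finset V)}
    (h : Disjoint T₁ T₂) :
    tilingColorCount f (T₁ ∪ T₂) c = tilingColorCount f T₁ c + tilingColorCount f T₂ c := by
  rw [count_eq, Finset.sum_union h]; rfl

theorem tiling_card {G : SimpleGraph V} {r : ℕ} {T : Finset (Finset V)} {W : Finset V}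
    (h : IsKrTilingOn G r T W) : W.card = T.card * r := by
  rw [← h.2.2, Finset.card_biUnion (t := id) (fun A hA B hB hAB => h.2.1 A hA B hB hAB),
    Finset.sum_congr rfl (fun K hK => show (id K).card = r from (h.1 K hK).card_eq), Finset.sum_const, smul_eq_mul]

theorem sum_tiling {M : Type*} [AddCommMonoid M] {G : SimpleGraph V} {r : ℕ}
    {T : Finset (Finset V)} {W : Finset V}
    (h : IsKrTilingOn G r T W) (w : V → M) : ∑ x ∈ W, w x = ∑ K ∈ T, ∑ x ∈ K, w x := by
  rw [← h.2.2, Finset.sum_biUnion (t := id) (fun A hA B hB hAB => h.2.1 A hA B hB hAB)]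
  rfl

end KrCore

namespace KrCore
open scoped Classical

variable {V : Type*} [DecidableEq V] {q : ℕ}

structure Env (G : SimpleGraph V) (W : Finset V) (r D : ℕ) : Prop where
  hr : 3 ≤ r
  deg : LowD G W D
  big : r * D + 3 * r + 3 ≤ W.card

variable {G : SimpleGraph V} {W : Finset V} {r D : ℕ}

/-- `P` is completely joined to `u` -/
def Full (G : SimpleGraph V) (P : Finset V) (u : V) : Prop := ∀ p ∈ P, G.Adj u p

theorem Full.notMem {P : Finset V} {u : V} (h : Full G P u) : u ∉ P := fun hu => G.irrefl (h u hu)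

theorem Full.subset {P Q : Finset V} {u : V} (h : Full G P u) (hQ : Q ⊆ P) : Full G Q u :=
  fun p hp => h p (hQ hp)

theorem common_card (hE : Env G W r D) {P : Finset V} (hP : P ⊆ W) (hPr : P.card ≤ r) :
    W.card ≤ (W.filter (fun u => Full G P u)).card + r * D := by
  have h1 : W ⊆ (W.filter (fun u => Full G P u)) ∪ P.biUnion (fun p => nonb G p W) := by
    intro u hu
    by_cases h : Full G P u
    · exact Finset.mem_union_left _ (Finset.mem_filter.2 ⟨hu, h⟩)
    · apply Finset.mem_union_right
      unfold Full at h
      push Not at h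
      obtain ⟨p, hp, hup⟩ := h
      exact Finset.mem_biUnion.2 ⟨p, hp, mem_nonb.2 ⟨hu, fun h => hup h.symm⟩⟩
  have h2 := Finset.card_le_card h1
  have h3 : (P.biUnion (fun p => nonb G p W)).card ≤ P.card * D :=
    Finset.card_biUnion_le_card_mul _ _ _ fun p hp => hE.deg p (hP hp)
  have h4 := Finset.card_union_le (W.filter (fun u => Full G P u)) (P.biUnion (fun p => nonb G p W))
  have h5 := Nat.mul_le_mul_right D hPr
  omega

theorem common (hE : Env G W r D) {P : Finset V} (hP : P ⊆ W) (hPr : P.card ≤ r) {Z : Finset V}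
    (hZ : Z.card < 3 * r + 3) : ∃ u ∈ W, u ∉ Z ∧ Full G P u := by
  have h1 := common_card hE hP hPr
  have h2 := hE.big
  have h3 : Z.card < (W.filter (fun u => Full G P u)).card := by omega
  obtain ⟨u, hu, huZ⟩ := Finset.exists_mem_notMem_of_card_lt_card h3
  obtain ⟨h4, h5⟩ := Finset.mem_filter.1 hu
  exact ⟨u, h4, huZ, h5⟩

theorem ext (hE : Env G W r D) {P : Finset V} (hP : P ⊆ W) {Z : Finset V}
    (hZ : Z.card < 3 * r + 3) (j : ℕ) (hj : P.card + j ≤ r + 1) :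
    ∃ Q ⊆ W, G.IsNClique j Q ∧ Disjoint Q Z ∧ ∀ p ∈ P, Full G Q p := by
  induction j with
  | zero => exact ⟨∅, by simp, by simp, by simp, fun p _ x hx => absurd hx (by simp)⟩
  | succ j ih =>
    obtain ⟨Q, hQ, hQc, hQZ, hQP⟩ := ih (by omega)
    obtain ⟨u, hu, huZ, huP⟩ := common hE (P := P ∪ Q) (Finset.union_subset hP hQ)
      (by have := Finset.card_union_le P Q; rw [hQc.card_eq] at this; omega) hZ
    refine ⟨insert u Q, Finset.insert_subset hu hQ,
      hQc.insert (fun b hb => huP b (Finset.mem_union_right _ hb)), ?_, ?_⟩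
    · rw [Finset.disjoint_insert_left]; exact ⟨huZ, hQZ⟩
    · intro p hp x hx
      rcases Finset.mem_insert.1 hx with rfl | hx
      · exact (huP p (Finset.mem_union_left _ hp)).symm
      · exact hQP p hp x hx

/-- no gadgets inside `W` -/
def NoGad (G : SimpleGraph V) (W : Finset V) (r : ℕ) (f : Sym2 V → Fin q) : Prop :=
  ∀ S ⊆ W, S.card ≤ 3 * r → ∀ T₁ T₂, IsKrTilingOn G r T₁ S → IsKrTilingOn G r T₂ S →
    ∀ c, tilingColorCount f T₁ c = tilingColorCount f T₂ c

variable {f : Sym2 V → Fin q} {c : Fin q}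

theorem full_clique (hr : 0 < r) {Q : Finset V} (hQ : G.IsNClique (r - 1) Q) {x : V}
    (hx : Full G Q x) : G.IsNClique r (insert x Q) := by
  have := hQ.insert hx
  rwa [Nat.sub_add_cancel hr] at this

theorem count_two {A B : Finset V} (hr : 0 < r) (hA : G.IsNClique r A) (hB : G.IsNClique r B)
    (hAB : Disjoint A B) : IsKrTilingOn G r ({A} ∪ {B}) (A ∪ B) ∧
      ∀ c, tilingColorCount f ({A} ∪ {B}) c = ec f c A + ec f c B := by
  obtain ⟨h1, h2⟩ := tiling_union hr (tiling_single hA) (tiling_single hB) hAB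
  refine ⟨h1, fun c => ?_⟩
  rw [count_union f c h2]
  simp [count_eq]

theorem count_three {A B C : Finset V} (hr : 0 < r) (hA : G.IsNClique r A) (hB : G.IsNClique r B)
    (hC : G.IsNClique r C) (hAB : Disjoint A B) (hAC : Disjoint A C) (hBC : Disjoint B C) :
    IsKrTilingOn G r ({A} ∪ {B} ∪ {C}) (A ∪ B ∪ C) ∧
      ∀ c, tilingColorCount f ({A} ∪ {B} ∪ {C}) c = ec f c A + ec f c B + ec f c C := by
  obtain ⟨h1, h2⟩ := count_two (f := f) hr hA hB hAB
  obtain ⟨h3, h4⟩ := tiling_union hr h1 (tiling_single hC) (Finset.disjoint_union_left.2 ⟨hAC, hBC⟩)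
  refine ⟨h3, fun c => ?_⟩
  rw [count_union f c h4, h2 c]
  simp [count_eq]

theorem swap_disj (hE : Env G W r D) (hng : NoGad G W r f) {Q Q' : Finset V} {x y : V}
    (hQ : Q ⊆ W) (hQ' : Q' ⊆ W) (hx : x ∈ W) (hy : y ∈ W) (cQ : G.IsNClique (r - 1) Q)
    (cQ' : G.IsNClique (r - 1) Q') (hd : Disjoint Q Q') (xQ : Full G Q x) (yQ : Full G Q y)
    (xQ' : Full G Q' x) (yQ' : Full G Q' y) :
    ec f c (insert x Q) + ec f c (insert y Q') = ec f c (insert y Q) + ec f c (insert x Q') := by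
  by_cases hxy : x = y
  · rw [hxy]
  have hr : 0 < r := by have := hE.hr; omega
  have d1 : Disjoint (insert x Q) (insert y Q') := by
    rw [Finset.disjoint_insert_left, Finset.disjoint_insert_right, Finset.mem_insert]
    exact ⟨by rintro (h | h); exacts [hxy h, xQ'.notMem h], yQ.notMem, hd⟩
  have d2 : Disjoint (insert y Q) (insert x Q') := by
    rw [Finset.disjoint_insert_left, Finset.disjoint_insert_right, Finset.mem_insert]
    exact ⟨by rintro (h | h); exacts [hxy h.symm, yQ'.notMem h], xQ.notMem, hd⟩
  obtain ⟨t1, n1⟩ := count_two (f := f) hr (full_clique hr cQ xQ) (full_clique hr cQ' yQ') d1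
  obtain ⟨t2, n2⟩ := count_two (f := f) hr (full_clique hr cQ yQ) (full_clique hr cQ' xQ') d2
  have hS : insert y Q ∪ insert x Q' = insert x Q ∪ insert y Q' := by
    ext u; simp only [Finset.mem_union, Finset.mem_insert]; tauto
  rw [hS] at t2
  rw [← n1 c, ← n2 c]
  refine hng _ ?_ ?_ _ _ t1 t2 c
  · exact Finset.union_subset (Finset.insert_subset hx hQ) (Finset.insert_subset hy hQ')
  · rw [Finset.card_union_of_disjoint d1, (full_clique hr cQ xQ).card_eq,
      (full_clique hr cQ' yQ').card_eq]
    omega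

theorem swap_any (hE : Env G W r D) (hng : NoGad G W r f) {Q Q' : Finset V} {x y : V}
    (hQ : Q ⊆ W) (hQ' : Q' ⊆ W) (hx : x ∈ W) (hy : y ∈ W) (cQ : G.IsNClique (r - 1) Q)
    (cQ' : G.IsNClique (r - 1) Q') (xQ : Full G Q x) (yQ : Full G Q y)
    (xQ' : Full G Q' x) (yQ' : Full G Q' y) :
    ec f c (insert x Q) + ec f c (insert y Q') = ec f c (insert y Q) + ec f c (insert x Q') := by
  have hr := hE.hr
  obtain ⟨R, hR, cR, dR, fR⟩ := ext hE (P := {x, y}) (by simp [Finset.insert_subset_iff, hx, hy])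
    (Z := Q ∪ Q') (by
      have := Finset.card_union_le Q Q'; rw [cQ.card_eq, cQ'.card_eq] at this; omega) (r - 1)
    (by have := Finset.card_le_two (a := x) (b := y); omega)
  rw [Finset.disjoint_union_right] at dR
  have h1 := swap_disj (c := c) hE hng hQ hR hx hy cQ cR dR.1.symm xQ yQ (fR x (by simp))
    (fR y (by simp))
  have h2 := swap_disj (c := c) hE hng hQ' hR hx hy cQ' cR dR.2.symm xQ' yQ' (fR x (by simp))
    (fR y (by simp))
  omega

theorem phi_exists (hE : Env G W r D) (hng : NoGad G W r f) (c : Fin q) : ∃ φ : V → V → ℤ,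
    ∀ x ∈ W, ∀ y ∈ W, ∀ Q ⊆ W, G.IsNClique (r - 1) Q → Full G Q x → Full G Q y →
      (ec f c (insert x Q) : ℤ) - ec f c (insert y Q) = φ x y := by
  have key : ∀ x y : V, ∃ d : ℤ, x ∈ W → y ∈ W → ∀ Q ⊆ W, G.IsNClique (r - 1) Q → Full G Q x →
      Full G Q y → (ec f c (insert x Q) : ℤ) - ec f c (insert y Q) = d := by
    intro x y
    by_cases h : ∃ Q ⊆ W, G.IsNClique (r - 1) Q ∧ Full G Q x ∧ Full G Q y
    · obtain ⟨Q, hQ, cQ, xQ, yQ⟩ := h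
      refine ⟨(ec f c (insert x Q) : ℤ) - ec f c (insert y Q), fun hx hy Q' hQ' cQ' xQ' yQ' => ?_⟩
      have := swap_any (c := c) hE hng hQ hQ' hx hy cQ cQ' xQ yQ xQ' yQ'
      omega
    · exact ⟨0, fun _ _ Q hQ cQ xQ yQ => absurd ⟨Q, hQ, cQ, xQ, yQ⟩ h⟩
  choose φ hφ using key
  exact ⟨φ, fun x hx y hy Q hQ cQ xQ yQ => hφ x y hx hy Q hQ cQ xQ yQ⟩

theorem pot_exists (hE : Env G W r D) (hng : NoGad G W r f) (c : Fin q) : ∃ v : V → ℤ,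
    ∀ x ∈ W, ∀ y ∈ W, ∀ Q ⊆ W, G.IsNClique (r - 1) Q → Full G Q x → Full G Q y →
      (ec f c (insert x Q) : ℤ) - ec f c (insert y Q) = v x - v y := by
  obtain ⟨φ, hφ⟩ := phi_exists hE hng c
  have hr := hE.hr
  obtain ⟨z, hz⟩ : W.Nonempty := by
    rw [← Finset.card_pos]; have := hE.big; omega
  refine ⟨fun x => φ x z, ?_⟩
  intro x hx y hy Q₁ hQ₁ c₁ xQ₁ yQ₁
  have hpair : ∀ a ∈ W, ∀ b ∈ W, ∀ Z : Finset V, Z.card < 3 * r + 3 →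
      ∃ Q ⊆ W, G.IsNClique (r - 1) Q ∧ Disjoint Q Z ∧ Full G Q a ∧ Full G Q b := by
    intro a ha b hb Z hZ
    obtain ⟨R, hR, cR, dR, fR⟩ := ext hE (P := {a, b}) (by simp [Finset.insert_subset_iff, ha, hb])
      hZ (r - 1) (by have := Finset.card_le_two (a := a) (b := b); omega)
    exact ⟨R, hR, cR, dR, fR a (by simp), fR b (by simp)⟩
  have hself : ∀ a ∈ W, φ a a = 0 := by
    intro a ha
    obtain ⟨Q, hQ, cQ, _, aQ, _⟩ := hpair a ha a ha ∅ (by simp)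
    have := hφ a ha a ha Q hQ cQ aQ aQ
    omega
  have hanti : ∀ a ∈ W, ∀ b ∈ W, φ a b = - φ b a := by
    intro a ha b hb
    obtain ⟨Q, hQ, cQ, _, aQ, bQ⟩ := hpair a ha b hb ∅ (by simp)
    have h1 := hφ a ha b hb Q hQ cQ aQ bQ
    have h2 := hφ b hb a ha Q hQ cQ bQ aQ
    omega
  rw [hφ x hx y hy Q₁ hQ₁ c₁ xQ₁ yQ₁]
  show φ x y = φ x z - φ y z
  by_cases hxy : x = y
  · rw [hxy, hself y hy]; ring
  by_cases hxz : x = z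
  · rw [hxz, hself z hz, hanti y hy z hz]; ring
  by_cases hyz : y = z
  · rw [hyz, hself z hz]; ring
  have hr0 : 0 < r := by omega
  obtain ⟨A, hA, cA, dA, xA, yA⟩ := hpair x hx y hy {z} (by simp)
  obtain ⟨B, hB, cB, dB, yB, zB⟩ := hpair y hy z hz (insert x A) (by
    have := Finset.card_insert_le x A; rw [cA.card_eq] at this; omega)
  obtain ⟨C, hC, cC, dC, xC, zC⟩ := hpair x hx z hz (insert y (A ∪ B)) (by
    have := Finset.card_insert_le y (A ∪ B)
    have h2 := Finset.card_union_le A B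
    rw [cA.card_eq, cB.card_eq] at h2; omega)
  rw [Finset.disjoint_singleton_right] at dA
  rw [Finset.disjoint_insert_right] at dB dC
  rw [Finset.disjoint_union_right] at dC
  obtain ⟨dB1, dB2⟩ := dB
  obtain ⟨dC1, dC2, dC3⟩ := dC
  have xA' := xA.notMem
  have yA' := yA.notMem
  have yB' := yB.notMem
  have zB' := zB.notMem
  have xC' := xC.notMem
  have zC' := zC.notMem
  have disj : ∀ {a b : V} {P R : Finset V}, a ≠ b → a ∉ R → b ∉ P → Disjoint P R →
      Disjoint (insert a P) (insert b R) := by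
    intro a b P R h1 h2 h3 h4
    rw [Finset.disjoint_insert_left, Finset.disjoint_insert_right, Finset.mem_insert]
    exact ⟨by rintro (h | h); exacts [h1 h, h2 h], h3, h4⟩
  obtain ⟨t1, n1⟩ := count_three (f := f) hr0 (full_clique hr0 cA xA) (full_clique hr0 cB yB)
    (full_clique hr0 cC zC) (disj hxy dB1 yA' dB2.symm) (disj hxz xC' dA dC2.symm)
    (disj hyz dC1 zB' dC3.symm)
  obtain ⟨t2, n2⟩ := count_three (f := f) hr0 (full_clique hr0 cA yA) (full_clique hr0 cB zB)
    (full_clique hr0 cC xC) (disj hyz yB' dA dB2.symm) (disj (Ne.symm hxy) dC1 xA' dC2.symm)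
    (disj (Ne.symm hxz) zC' dB1 dC3.symm)
  have hS : insert y A ∪ insert z B ∪ insert x C = insert x A ∪ insert y B ∪ insert z C := by
    ext u; simp only [Finset.mem_union, Finset.mem_insert]; tauto
  rw [hS] at t2
  have hmain := hng _ (by
      exact Finset.union_subset (Finset.union_subset (Finset.insert_subset hx hA)
        (Finset.insert_subset hy hB)) (Finset.insert_subset hz hC)) (by
      refine (Finset.card_union_le _ _).trans ?_
      have := Finset.card_union_le (insert x A) (insert y B)
      rw [(full_clique hr0 cA xA).card_eq, (full_clique hr0 cB yB).card_eq] at this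
      rw [(full_clique hr0 cC zC).card_eq]
      omega) _ _ t1 t2 c
  rw [n1 c, n2 c] at hmain
  have e1 := hφ x hx y hy A hA cA xA yA
  have e2 := hφ y hy z hz B hB cB yB zB
  have e3 := hφ x hx z hz C hC cC xC zC
  omega

theorem walk (hr : 0 < r) {Good : Finset V → Prop} {v : V}
    (step : ∀ K ⊆ W, G.IsNClique r K → Good K → ∀ Q ⊆ K, G.IsNClique (r - 1) Q →
      ∃ u ∈ W, G.Adj u v ∧ Full G Q u ∧ Good (insert u Q)) {P : Finset V} (hPv : Full G P v)
    (hPr : P.card ≤ r - 1) :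
    ∀ (n : ℕ) (K : Finset V), (nonb G v K).card ≤ n → K ⊆ W → G.IsNClique r K → Good K → P ⊆ K →
      ∃ K' ⊆ W, G.IsNClique r K' ∧ Good K' ∧ ∃ Q ⊆ K', P ⊆ Q ∧ G.IsNClique (r - 1) Q ∧ Full G Q v := by
  intro n
  induction n with
  | zero =>
    intro K hn hKW cK gK hPK
    obtain ⟨Q, h1, h2, h3⟩ := Finset.exists_subsuperset_card_eq hPK hPr
      (by rw [cK.card_eq]; omega)
    refine ⟨K, hKW, cK, gK, Q, h2, h1, ⟨cK.1.subset h2, h3⟩, ?_⟩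
    intro x hx
    by_contra hcon
    have : 0 < (nonb G v K).card := Finset.card_pos.2 ⟨x, mem_nonb.2 ⟨h2 hx, hcon⟩⟩
    omega
  | succ n ih =>
    intro K hn hKW cK gK hPK
    by_cases hne : (nonb G v K).Nonempty
    · obtain ⟨x, hx⟩ := hne
      obtain ⟨hxK, hxv⟩ := mem_nonb.1 hx
      have cQ : G.IsNClique (r - 1) (K.erase x) :=
        ⟨cK.1.subset (by simp), by rw [Finset.card_erase_of_mem hxK, cK.card_eq]⟩
      obtain ⟨u, huW, huv, huQ, gu⟩ := step K hKW cK gK (K.erase x) (Finset.erase_subset _ _) cQ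
      refine ih (insert u (K.erase x)) ?_ (Finset.insert_subset huW
        ((Finset.erase_subset _ _).trans hKW)) (full_clique hr cQ huQ) gu ?_
      · have h1 : nonb G v (insert u (K.erase x)) ⊆ (nonb G v K).erase x := by
          intro y hy
          obtain ⟨h1, h2⟩ := mem_nonb.1 hy
          rcases Finset.mem_insert.1 h1 with rfl | h1
          · exact absurd huv.symm h2
          · obtain ⟨h3, h4⟩ := Finset.mem_erase.1 h1
            exact Finset.mem_erase.2 ⟨h3, mem_nonb.2 ⟨h4, h2⟩⟩
        have h2 := Finset.card_le_card h1
        rw [Finset.card_erase_of_mem hx] at h2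
        omega
      · intro p hp
        refine Finset.mem_insert_of_mem (Finset.mem_erase.2 ⟨?_, hPK hp⟩)
        rintro rfl
        exact hxv (hPv p hp)
    · rw [Finset.not_nonempty_iff_eq_empty] at hne
      exact ih K (by rw [hne]; simp) hKW cK gK hPK

theorem weight_exists (hE : Env G W r D) (hng : NoGad G W r f) (c : Fin q) : ∃ w : V → ℚ,
    ∀ K ⊆ W, G.IsNClique r K → (ec f c K : ℚ) = ∑ x ∈ K, w x := by
  obtain ⟨v, hv⟩ := pot_exists hE hng c
  have hr := hE.hr
  have hr0 : 0 < r := by omega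
  set dl : Finset V → ℤ := fun K => (ec f c K : ℤ) - ∑ x ∈ K, v x with hdl
  have hswap : ∀ x ∈ W, ∀ y ∈ W, ∀ Q ⊆ W, G.IsNClique (r - 1) Q → Full G Q x → Full G Q y →
      dl (insert x Q) = dl (insert y Q) := by
    intro x hx y hy Q hQ cQ xQ yQ
    have := hv x hx y hy Q hQ cQ xQ yQ
    simp only [hdl]
    rw [Finset.sum_insert xQ.notMem, Finset.sum_insert yQ.notMem]
    omega
  have hext : ∀ K ⊆ W, G.IsNClique r K → ∀ Q ⊆ K, G.IsNClique (r - 1) Q → ∃ x ∈ W, Full G Q x ∧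
      insert x Q = K := by
    intro K hK cK Q hQ cQ
    obtain ⟨x, hx, hxQ⟩ := Finset.exists_mem_notMem_of_card_lt_card
      (s := Q) (t := K) (by rw [cQ.card_eq, cK.card_eq]; omega)
    refine ⟨x, hK hx, ?_, ?_⟩
    · intro p hp
      exact cK.1 hx (hQ hp) (by rintro rfl; exact hxQ hp)
    · apply Finset.eq_of_subset_of_card_le (Finset.insert_subset hx hQ)
      rw [Finset.card_insert_of_notMem hxQ, cQ.card_eq, cK.card_eq]; omega
  have hconst : ∀ K ⊆ W, G.IsNClique r K → ∀ K' ⊆ W, G.IsNClique r K' → dl K = dl K' := by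
    intro K hK cK K' hK' cK'
    have key : ∀ P ⊆ K', ∃ L ⊆ W, G.IsNClique r L ∧ dl L = dl K ∧ P ⊆ L := by
      intro P
      induction P using Finset.induction_on with
      | empty => exact fun _ => ⟨K, hK, cK, rfl, by simp⟩
      | insert y P hy ih =>
        intro hP
        obtain ⟨hyK, hPK⟩ := Finset.insert_subset_iff.1 hP
        obtain ⟨L, hL, cL, dL, hPL⟩ := ih hPK
        have hyP : Full G P y := fun p hp => cK'.1 hyK (hPK hp) (by rintro rfl; exact hy hp)
        have hPr : P.card ≤ r - 1 := by
          have := Finset.card_le_card hP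
          rw [Finset.card_insert_of_notMem hy, cK'.card_eq] at this
          omega
        obtain ⟨L', hL', cL', dL', Q, hQL, hPQ, cQ, fQ⟩ := walk (W := W) hr0
          (Good := fun L => dl L = dl K) (v := y) (by
            intro A hA cA gA Q hQ cQ
            obtain ⟨x, hx, xQ, hxA⟩ := hext A hA cA Q hQ cQ
            obtain ⟨u, hu, _, huQ⟩ := common hE (P := insert y Q)
              (Finset.insert_subset (hK' hyK) (hQ.trans hA))
              (by have := Finset.card_insert_le y Q; rw [cQ.card_eq] at this; omega)
              (Z := ∅) (by simp)
            have huQ' := huQ.subset (Finset.subset_insert y Q)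
            refine ⟨u, hu, huQ y (by simp), huQ', ?_⟩
            rw [hswap u hu x hx Q (hQ.trans hA) cQ huQ' xQ, hxA, gA]) hyP hPr _ L le_rfl hL cL dL hPL
        obtain ⟨x, hx, xQ, hxL⟩ := hext L' hL' cL' Q hQL cQ
        refine ⟨insert y Q, Finset.insert_subset (hK' hyK) (hQL.trans hL'), full_clique hr0 cQ fQ, ?_,
          Finset.insert_subset_insert _ hPQ⟩
        rw [hswap y (hK' hyK) x hx Q (hQL.trans hL') cQ fQ xQ, hxL, dL']
    obtain ⟨L, _, cL, dL, hKL⟩ := key K' subset_rfl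
    rw [Finset.eq_of_subset_of_card_le hKL (by rw [cL.card_eq, cK'.card_eq]), dL]
  obtain ⟨K₀, hK₀, cK₀, _⟩ := ext hE (P := ∅) (by simp) (Z := ∅) (by simp) r (by simp)
  refine ⟨fun x => v x + (dl K₀ : ℚ) / r, fun K hK cK => ?_⟩
  have h1 := hconst K hK cK K₀ hK₀ cK₀
  rw [Finset.sum_add_distrib, Finset.sum_const, cK.card_eq, ← h1, nsmul_eq_mul]
  have : (r : ℚ) ≠ 0 := by positivity
  rw [mul_div_cancel₀ _ this]
  simp only [hdl]
  push_cast
  ring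

end KrCore

namespace KrCore
open scoped Classical

variable {V : Type*} [DecidableEq V] {q : ℕ}
variable {G : SimpleGraph V} {W : Finset V} {r D : ℕ}
variable {f : Sym2 V → Fin q} {c : Fin q}

/-- `w` is a vertex weighting representing the color count of `c` -/
def Wt (G : SimpleGraph V) (W : Finset V) (r : ℕ) (f : Sym2 V → Fin q) (c : Fin q) (w : V → ℚ) :
    Prop := ∀ K ⊆ W, G.IsNClique r K → (ec f c K : ℚ) = ∑ x ∈ K, w x

theorem Wt.count {w : V → ℚ} (hw : Wt G W r f c w) {S : Finset V} (hS : S ⊆ W)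
    {T : Finset (Finset V)} (hT : IsKrTilingOn G r T S) :
    (tilingColorCount f T c : ℚ) = ∑ x ∈ S, w x := by
  rw [sum_tiling hT, count_eq, Nat.cast_sum]
  exact Finset.sum_congr rfl fun K hK => hw K ((tiling_sub hT hK).trans hS) (hT.1 K hK)

/-- small weight in common neighbourhoods -/
def Low (G : SimpleGraph V) (W : Finset V) (r : ℕ) (w : V → ℚ) : Prop :=
  ∀ P ⊆ W, P.card ≤ r → ∃ u ∈ W, Full G P u ∧ 2 * w u < r - 1

theorem low_of (hE : Env G W r D) {w : V → ℚ} (hw : Wt G W r f c w)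
    (h2 : 2 * ∑ x ∈ W, w x < ((r : ℚ) - 1) * ((W.card : ℚ) - r * D)) : Low G W r w := by
  intro P hP hPr
  by_contra hcon
  push Not at hcon
  have h1 := common_card hE hP hPr
  have hb := hE.big
  obtain ⟨X, hXU, hX⟩ := Finset.exists_subset_card_eq
    (s := W.filter (fun u => Full G P u)) (n := W.card - r * D) (by omega)
  have hXW : X ⊆ W := hXU.trans (Finset.filter_subset _ _)
  obtain ⟨T, hT⟩ := tile (G := G) (W := W \ X) (r := r) (D := D)
    (by rw [Finset.card_sdiff_of_subset hXW, hX, mul_comm D]; omega)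
    (hE.deg.mono Finset.sdiff_subset le_rfl)
  have h3 : 0 ≤ ∑ x ∈ W \ X, w x := by
    rw [← hw.count Finset.sdiff_subset hT]; positivity
  have h4 : ∑ x ∈ X, ((r : ℚ) - 1) ≤ ∑ x ∈ X, 2 * w x := by
    refine Finset.sum_le_sum fun x hx => ?_
    obtain ⟨h5, h6⟩ := Finset.mem_filter.1 (hXU hx)
    exact hcon x h5 h6
  rw [Finset.sum_const, hX, nsmul_eq_mul, ← Finset.mul_sum, Nat.cast_sub (by omega)] at h4
  rw [← Finset.sum_sdiff hXW] at h2
  push_cast at h4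
  linarith

/-- a zero clique of size `r-1` -/
structure ZQ (G : SimpleGraph V) (W : Finset V) (r : ℕ) (f : Sym2 V → Fin q) (c : Fin q)
    (w : V → ℚ) (Q : Finset V) : Prop where
  sub : Q ⊆ W
  cl : G.IsNClique (r - 1) Q
  zero : ∀ x ∈ Q, w x = 0
  e0 : ec f c Q = 0

theorem ZQ.wt (hr : 0 < r) {w : V → ℚ} (hw : Wt G W r f c w) {Q : Finset V}
    (hQ : ZQ G W r f c w Q) {u : V} (hu : u ∈ W) (uQ : Full G Q u) : w u = dc f c u Q := by
  have h1 := hw (insert u Q) (Finset.insert_subset hu hQ.sub) (full_clique hr hQ.cl uQ)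
  rw [Finset.sum_insert uQ.notMem, Finset.sum_eq_zero hQ.zero, add_zero,
    ec_insert f c uQ.notMem, hQ.e0, zero_add] at h1
  exact h1.symm

theorem ZQ.pair (hr : 3 ≤ r) {w : V → ℚ} (hw : Wt G W r f c w) {Q : Finset V}
    (hQ : ZQ G W r f c w Q) {u u' : V} (hu : u ∈ W) (hu' : u' ∈ W) (uQ : Full G Q u)
    (uQ' : Full G Q u') (huu : G.Adj u u') :
    w u + w u' = ((r : ℚ) - 1) * (if f s(u', u) = c then 1 else 0) := by
  have hr0 : 0 < r := by omega
  have key : ∀ s ∈ Q, (if f s(u', u) = c then (1 : ℚ) else 0) =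
      (if f s(u, s) = c then 1 else 0) + (if f s(u', s) = c then 1 else 0) := by
    intro s hs
    have hne : u' ≠ u := huu.ne'
    have cQs : G.IsNClique (r - 1 - 1) (Q.erase s) :=
      ⟨hQ.cl.1.subset (by simp), by rw [Finset.card_erase_of_mem hs, hQ.cl.card_eq]⟩
    have f1 : Full G (Q.erase s) u := uQ.subset (Finset.erase_subset _ _)
    have f2 : Full G (insert u (Q.erase s)) u' := by
      intro p hp
      rcases Finset.mem_insert.1 hp with rfl | hp
      · exact huu.symm
      · exact uQ' p (Finset.mem_of_mem_erase hp)
    have cl := full_clique hr0 (full_clique (by omega) cQs f1) f2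
    have h1 := hw _ (Finset.insert_subset hu' (Finset.insert_subset hu
      ((Finset.erase_subset _ _).trans hQ.sub))) cl
    rw [Finset.sum_insert f2.notMem, Finset.sum_insert f1.notMem,
      Finset.sum_eq_zero (fun x hx => hQ.zero x (Finset.mem_of_mem_erase hx)), add_zero,
      ec_insert f c f2.notMem, ec_insert f c f1.notMem, dc_insert f c f1.notMem,
      hQ.wt hr0 hw hu uQ, hQ.wt hr0 hw hu' uQ'] at h1
    have h2 : ec f c (Q.erase s) = 0 := by
      have := ec_mono f c (Finset.erase_subset s Q)
      rw [hQ.e0] at this; omega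
    have h3 : ∀ z, dc f c z Q = dc f c z (Q.erase s) + if f s(z, s) = c then 1 else 0 := by
      intro z
      conv_lhs => rw [← Finset.insert_erase hs]
      exact dc_insert f c (by simp)
    rw [h2, h3 u, h3 u'] at h1
    push_cast at h1
    linarith
  have h1 := Finset.sum_congr (s₁ := Q) rfl key
  rw [Finset.sum_const, hQ.cl.card_eq, nsmul_eq_mul, Nat.cast_sub (by omega),
    Finset.sum_add_distrib] at h1
  rw [hQ.wt hr0 hw hu uQ, hQ.wt hr0 hw hu' uQ', dc_eq_sum, dc_eq_sum]
  push_cast at h1 ⊢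
  exact h1.symm

theorem ZQ.dich (hr : 3 ≤ r) {w : V → ℚ} (hw : Wt G W r f c w) (hl : Low G W r w) {Q : Finset V}
    (hQ : ZQ G W r f c w Q) {u : V} (hu : u ∈ W) (uQ : Full G Q u) :
    w u = 0 ∨ w u = (r : ℚ) - 1 := by
  have hr0 : 0 < r := by omega
  have hnn : ∀ x ∈ W, Full G Q x → 0 ≤ w x := fun x hx xQ => by
    rw [hQ.wt hr0 hw hx xQ]; positivity
  have step : ∀ x ∈ W, Full G Q x → 0 < w x → (r : ℚ) - 1 < 2 * w x ∧
      ∃ y ∈ W, Full G Q y ∧ w x + w y = (r : ℚ) - 1 ∧ 2 * w y < (r : ℚ) - 1 := by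
    intro x hx xQ hx0
    obtain ⟨y, hy, hyP, hyl⟩ := hl (insert x Q) (Finset.insert_subset hx hQ.sub)
      (by have := Finset.card_insert_le x Q; rw [hQ.cl.card_eq] at this; omega)
    have yQ := hyP.subset (Finset.subset_insert x Q)
    have h1 := hQ.pair hr hw hx hy xQ yQ (hyP x (by simp)).symm
    have h2 := hnn y hy yQ
    split_ifs at h1
    · rw [mul_one] at h1
      exact ⟨by linarith, y, hy, yQ, h1, hyl⟩
    · linarith
  by_cases h0 : w u = 0
  · exact Or.inl h0
  right
  have hpos : 0 < w u := lt_of_le_of_ne (hnn u hu uQ) (Ne.symm h0)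
  obtain ⟨_, y, hy, yQ, hsum, hyl⟩ := step u hu uQ hpos
  by_cases hy0 : w y = 0
  · linarith
  · have := (step y hy yQ (lt_of_le_of_ne (hnn y hy yQ) (Ne.symm hy0))).1
    linarith

/-- good color -/
def GoodC (W : Finset V) (r : ℕ) (w : V → ℚ) : Prop := ∀ x ∈ W, w x = 0 ∨ w x = (r : ℚ) - 1

theorem good_of_zero (hr : 3 ≤ r) {w : V → ℚ} (hw : Wt G W r f c w) (hl : Low G W r w)
    {K : Finset V} (hK : K ⊆ W) (cK : G.IsNClique r K) (h0 : ∀ x ∈ K, w x = 0) : GoodC W r w := by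
  intro v hv
  have hr0 : 0 < r := by omega
  have mk : ∀ L ⊆ W, G.IsNClique r L → (∀ x ∈ L, w x = 0) → ∀ Q ⊆ L, G.IsNClique (r - 1) Q →
      ZQ G W r f c w Q := by
    intro L hL cL zL Q hQ cQ
    refine ⟨hQ.trans hL, cQ, fun x hx => zL x (hQ hx), ?_⟩
    have h1 := hw L hL cL
    rw [Finset.sum_eq_zero zL] at h1
    have h2 : ec f c L = 0 := by exact_mod_cast h1
    have := ec_mono f c hQ
    omega
  obtain ⟨L, hL, cL, zL, Q, hQ, _, cQ, vQ⟩ := walk (W := W) (G := G) hr0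
    (Good := fun L => ∀ x ∈ L, w x = 0) (v := v) (by
      intro L hL cL zL Q hQ cQ
      have hz := mk L hL cL zL Q hQ cQ
      obtain ⟨u, hu, huP, hul⟩ := hl (insert v Q) (Finset.insert_subset hv (hQ.trans hL))
        (by have := Finset.card_insert_le v Q; rw [cQ.card_eq] at this; omega)
      have uQ := huP.subset (Finset.subset_insert v Q)
      refine ⟨u, hu, huP v (by simp), uQ, ?_⟩
      intro x hx
      rcases Finset.mem_insert.1 hx with rfl | hx
      · rcases hz.dich hr hw hl hu uQ with h | h
        · exact h
        · rw [h] at hul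
          have : (3 : ℚ) ≤ r := by exact_mod_cast hr
          linarith
      · exact zL x (hQ hx)) (P := ∅) (fun p hp => absurd hp (by simp)) (by simp) _ K le_rfl hK cK h0
      (by simp)
  exact (mk L hL cL zL Q hQ cQ).dich hr hw hl hv vQ

theorem good_of_missing (hr : 3 ≤ r) {w : V → ℚ} (hw : Wt G W r f c w) (hl : Low G W r w)
    {A : Finset V} (hA : A ⊆ W) (cA : G.IsNClique (r + 1) A) (h0 : ec f c A = 0) :
    GoodC W r w := by
  have h1 : ∀ x ∈ A, w x = ∑ y ∈ A, w y := by
    intro x hx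
    have cl : G.IsNClique r (A.erase x) :=
      ⟨cA.1.subset (by simp), by rw [Finset.card_erase_of_mem hx, cA.card_eq]; rfl⟩
    have h2 := hw _ ((Finset.erase_subset x A).trans hA) cl
    have h3 : ec f c (A.erase x) = 0 := by
      have := ec_mono f c (Finset.erase_subset x A); omega
    rw [h3] at h2
    rw [← Finset.add_sum_erase _ _ hx, ← h2]
    simp
  have h2 := Finset.sum_congr (s₁ := A) rfl h1
  rw [Finset.sum_const, cA.card_eq, nsmul_eq_mul] at h2
  have h3 : ∑ y ∈ A, w y = 0 := by
    push_cast at h2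
    have h4 : (r : ℚ) * ∑ y ∈ A, w y = 0 := by linarith
    rcases mul_eq_zero.1 h4 with h | h
    · exfalso
      have : (3 : ℚ) ≤ r := by exact_mod_cast hr
      linarith
    · exact h
  obtain ⟨x, hx⟩ : A.Nonempty := by rw [← Finset.card_pos, cA.card_eq]; omega
  have cl : G.IsNClique r (A.erase x) :=
    ⟨cA.1.subset (by simp), by rw [Finset.card_erase_of_mem hx, cA.card_eq]; rfl⟩
  exact good_of_zero hr hw hl ((Finset.erase_subset x A).trans hA) cl
    (fun y hy => by rw [h1 y (Finset.mem_of_mem_erase hy), h3])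

theorem good_star (hr : 3 ≤ r) {w : V → ℚ} (hw : Wt G W r f c w) (hg : GoodC W r w)
    {x : V} (hx : x ∈ W) (hwx : w x = (r : ℚ) - 1) {K : Finset V} (hK : K ⊆ W)
    (cK : G.IsNClique r K) (xK : Full G K x) :
    ec f c K = 0 ∧ (∀ y ∈ K, w y = 0) ∧ ∀ y ∈ K, f s(x, y) = c := by
  have hr0 : 0 < r := by omega
  have hr3 : (3 : ℚ) ≤ r := by exact_mod_cast hr
  have hnn : ∀ y ∈ K, 0 ≤ w y := by
    intro y hy
    rcases hg y (hK hy) with h | h <;> rw [h]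
    linarith
  have h1 : ∀ y ∈ K, w y + dc f c x (K.erase y) = dc f c y (K.erase y) + ((r : ℚ) - 1) := by
    intro y hy
    have cl : G.IsNClique (r - 1) (K.erase y) :=
      ⟨cK.1.subset (by simp), by rw [Finset.card_erase_of_mem hy, cK.card_eq]⟩
    have xQ := xK.subset (Finset.erase_subset y K)
    have e1 := hw _ (Finset.insert_subset hx ((Finset.erase_subset y K).trans hK))
      (full_clique hr0 cl xQ)
    have e2 := hw K hK cK
    rw [Finset.sum_insert xQ.notMem, ec_insert f c xQ.notMem, hwx] at e1
    rw [ec_erase f c hy, ← Finset.add_sum_erase _ _ hy] at e2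
    push_cast at e1 e2
    linarith
  have hdle : ∀ y ∈ K, (dc f c x (K.erase y) : ℚ) ≤ (r : ℚ) - 1 := by
    intro y hy
    have h2 := dc_le f c x (K.erase y)
    rw [Finset.card_erase_of_mem hy, cK.card_eq] at h2
    have h3 : (dc f c x (K.erase y) : ℚ) ≤ ((r - 1 : ℕ) : ℚ) := by exact_mod_cast h2
    rw [Nat.cast_sub (by omega)] at h3
    simpa using h3
  have h2 : (∑ y ∈ K, (dc f c y (K.erase y) : ℚ)) ≤ ∑ y ∈ K, w y :=
    Finset.sum_le_sum fun y hy => by linarith [h1 y hy, hdle y hy]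
  have h3 : (∑ y ∈ K, (dc f c y (K.erase y) : ℚ)) = 2 * ec f c K := by
    exact_mod_cast handshake f c K
  have e2 := hw K hK cK
  have e0 : ec f c K = 0 := by
    rw [h3, ← e2] at h2
    have h4 : (ec f c K : ℚ) ≤ 0 := by linarith
    have h5 : ec f c K ≤ 0 := by exact_mod_cast h4
    omega
  have hz : ∀ y ∈ K, w y = 0 := by
    rw [e0, Nat.cast_zero] at e2
    exact (Finset.sum_eq_zero_iff_of_nonneg hnn).1 e2.symm
  refine ⟨e0, hz, ?_⟩
  intro y hy
  obtain ⟨z, hz', hzy⟩ := Finset.exists_mem_ne (s := K) (by rw [cK.card_eq]; omega) y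
  have h4 := h1 z hz'
  rw [hz z hz', zero_add] at h4
  have h5 : (r : ℚ) - 1 ≤ dc f c x (K.erase z) := by
    rw [h4]
    have : (0 : ℚ) ≤ dc f c z (K.erase z) := by positivity
    linarith
  have h6 : (K.erase z).card ≤ dc f c x (K.erase z) := by
    rw [Finset.card_erase_of_mem hz', cK.card_eq]
    have : ((r - 1 : ℕ) : ℚ) ≤ dc f c x (K.erase z) := by
      rw [Nat.cast_sub (by omega)]; simpa using h5
    exact_mod_cast this
  have h7 := Finset.eq_of_subset_of_card_le (Finset.filter_subset (fun y => f s(x, y) = c)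
    (K.erase z)) h6
  have h8 : y ∈ (K.erase z).filter (fun y => f s(x, y) = c) := by
    rw [h7]; exact Finset.mem_erase.2 ⟨hzy.symm, hy⟩
  exact (Finset.mem_filter.1 h8).2

theorem core (hE : Env G W r D) (hng : NoGad G W r f) (hq : r * r + r < 2 * q)
    {T : Finset (Finset V)} (hT : IsKrTilingOn G r T W)
    (h1 : ∀ c, (r - 1) * D < (r + 1) * tilingColorCount f T c)
    (h2 : ∀ c, 2 * (tilingColorCount f T c : ℚ) < ((r : ℚ) - 1) * ((W.card : ℚ) - r * D)) :
    False := by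
  have hr := hE.hr
  have hr0 : 0 < r := by omega
  have hr3 : (3 : ℚ) ≤ r := by exact_mod_cast hr
  choose w hw using fun c => weight_exists hE hng c
  have hw : ∀ c, Wt G W r f c (w c) := hw
  have hcnt : ∀ c, (tilingColorCount f T c : ℚ) = ∑ x ∈ W, w c x := fun c =>
    (hw c).count subset_rfl hT
  have hl : ∀ c, Low G W r (w c) := fun c => low_of hE (hw c) (by rw [← hcnt]; exact h2 c)
  have hmiss : ∀ A ⊆ W, G.IsNClique (r + 1) A → ∀ c, ec f c A = 0 → GoodC W r (w c) :=
    fun A hA cA c h0 => good_of_missing hr (hw c) (hl c) hA cA h0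
  -- a good color
  obtain ⟨A, hA, cA, _, _⟩ := ext hE (P := ∅) (by simp) (Z := ∅) (by simp) (r + 1) (by simp)
  obtain ⟨c₀, hc₀⟩ : ∃ c, ec f c A = 0 := by
    by_contra hcon
    push Not at hcon
    have h3 := ec_total f A
    have h4 : ∑ c : Fin q, 1 ≤ ∑ c, ec f c A :=
      Finset.sum_le_sum fun c _ => Nat.one_le_iff_ne_zero.2 (hcon c)
    simp only [Finset.sum_const, Finset.card_univ, Fintype.card_fin, smul_eq_mul, mul_one] at h4
    rw [cA.card_eq] at h3
    nlinarith
  have hg₀ := hmiss A hA cA c₀ hc₀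
  -- the support
  set S : Fin q → Finset V := fun c => W.filter (fun x => w c x = (r : ℚ) - 1) with hS
  have hScard : ∀ c, GoodC W r (w c) → D < (r + 1) * (S c).card := by
    intro c hg
    have h3 : ∑ x ∈ W, w c x = (S c).card * ((r : ℚ) - 1) := by
      rw [← Finset.sum_filter_add_sum_filter_not W (fun x => w c x = (r : ℚ) - 1)]
      rw [Finset.sum_congr rfl (fun x hx => (Finset.mem_filter.1 hx).2), Finset.sum_const,
        nsmul_eq_mul, Finset.sum_eq_zero, add_zero]
      intro x hx
      obtain ⟨h4, h5⟩ := Finset.mem_filter.1 hx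
      exact (hg x h4).resolve_right h5
    rw [← hcnt] at h3
    have h4 : tilingColorCount f T c = (S c).card * (r - 1) := by
      have : (tilingColorCount f T c : ℚ) = (((S c).card * (r - 1) : ℕ) : ℚ) := by
        rw [h3, Nat.cast_mul, Nat.cast_sub (by omega)]; simp
      exact_mod_cast this
    have h5 := h1 c
    rw [h4] at h5
    have h6 : (r - 1) * D < (r - 1) * ((r + 1) * (S c).card) := by
      calc (r - 1) * D < (r + 1) * ((S c).card * (r - 1)) := h5
        _ = _ := by ring
    exact Nat.lt_of_mul_lt_mul_left h6
  have hSne : ∀ c, GoodC W r (w c) → (S c).Nonempty := by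
    intro c hg
    rw [← Finset.card_pos]
    have := hScard c hg
    rcases Nat.eq_zero_or_pos (S c).card with h | h
    · rw [h] at this; omega
    · exact h
  obtain ⟨x, hx⟩ := hSne c₀ hg₀
  obtain ⟨hxW, hwx⟩ := Finset.mem_filter.1 hx
  obtain ⟨K, hK, cK, _, xK⟩ := ext hE (P := {x}) (by simpa using hxW) (Z := ∅) (by simp) r
    (by simp; omega)
  have xK := xK x (by simp)
  obtain ⟨eK, _, fK⟩ := good_star hr (hw c₀) hg₀ hxW hwx hK cK xK
  set M : Finset (Fin q) := univ.filter (fun c => ec f c K = 0) with hM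
  have hMgood : ∀ c ∈ M, GoodC W r (w c) := by
    intro c hc
    have hc' := (Finset.mem_filter.1 hc).2
    by_cases hcc : c = c₀
    · rw [hcc]; exact hg₀
    · refine hmiss (insert x K) (Finset.insert_subset hxW hK) (cK.insert xK) c ?_
      rw [ec_insert f c xK.notMem, hc', zero_add, dc, Finset.card_eq_zero,
        Finset.filter_eq_empty_iff]
      intro y hy h
      exact hcc (h.symm.trans (fK y hy))
  have hMcard : r + 1 ≤ M.card := by
    have h3 := ec_total f K
    have h4 : (univ.filter (fun c => ¬ ec f c K = 0)).card ≤ ∑ c, ec f c K := by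
      rw [Finset.card_filter]
      refine Finset.sum_le_sum fun c _ => ?_
      split_ifs <;> omega
    have h5 := Finset.card_filter_add_card_filter_not (s := (univ : Finset (Fin q)))
      (fun c => ec f c K = 0)
    rw [Finset.card_univ, Fintype.card_fin] at h5
    rw [cK.card_eq] at h3
    change M.card + _ = q at h5
    nlinarith
  -- independence
  have hind : ∀ c₁, GoodC W r (w c₁) → ∀ c₂, GoodC W r (w c₂) → ∀ y ∈ S c₁, ∀ z ∈ S c₂,
      ¬ G.Adj y z := by
    intro c₁ g₁ c₂ g₂ y hy z hz hyz
    obtain ⟨hyW, hwy⟩ := Finset.mem_filter.1 hy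
    obtain ⟨hzW, hwz⟩ := Finset.mem_filter.1 hz
    obtain ⟨L, hL, cL, _, fL⟩ := ext hE (P := {y, z})
      (by simp [Finset.insert_subset_iff, hyW, hzW]) (Z := ∅) (by simp) (r - 1)
      (by have := Finset.card_le_two (a := y) (b := z); omega)
    have yL := fL y (by simp)
    have zL := fL z (by simp)
    have yzL : Full G (insert z L) y := by
      intro p hp
      rcases Finset.mem_insert.1 hp with rfl | hp
      · exact hyz
      · exact yL p hp
    have zyL : Full G (insert y L) z := by
      intro p hp
      rcases Finset.mem_insert.1 hp with rfl | hp
      · exact hyz.symm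
      · exact zL p hp
    obtain ⟨_, a1, b1⟩ := good_star hr (hw c₁) g₁ hyW hwy (Finset.insert_subset hzW hL)
      (full_clique hr0 cL zL) yzL
    obtain ⟨_, a2, b2⟩ := good_star hr (hw c₂) g₂ hzW hwz (Finset.insert_subset hyW hL)
      (full_clique hr0 cL yL) zyL
    have h3 := b1 z (by simp)
    have h4 := b2 y (by simp)
    rw [Sym2.eq_swap, h3] at h4
    have h5 := a1 z (by simp)
    rw [h4, hwz] at h5
    linarith
  have hdisj : ∀ c₁ ∈ M, ∀ c₂ ∈ M, c₁ ≠ c₂ → Disjoint (S c₁) (S c₂) := by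
    intro c₁ m₁ c₂ m₂ hne
    rw [Finset.disjoint_left]
    intro y hy hy2
    obtain ⟨hyW, hwy⟩ := Finset.mem_filter.1 hy
    obtain ⟨_, hwy2⟩ := Finset.mem_filter.1 hy2
    obtain ⟨L, hL, cL, _, fL⟩ := ext hE (P := {y}) (by simpa using hyW) (Z := ∅) (by simp) r
      (by simp; omega)
    have yL := fL y (by simp)
    obtain ⟨_, _, b1⟩ := good_star hr (hw c₁) (hMgood _ m₁) hyW hwy hL cL yL
    obtain ⟨_, _, b2⟩ := good_star hr (hw c₂) (hMgood _ m₂) hyW hwy2 hL cL yL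
    obtain ⟨z, hz⟩ : L.Nonempty := by rw [← Finset.card_pos, cL.card_eq]; omega
    exact hne ((b1 z hz).symm.trans (b2 z hz))
  have hM0 : c₀ ∈ M := Finset.mem_filter.2 ⟨by simp, eK⟩
  have hle : (M.biUnion S).card ≤ D := by
    refine le_trans (Finset.card_le_card ?_) (hE.deg x hxW)
    intro y hy
    obtain ⟨c, hc, hyc⟩ := Finset.mem_biUnion.1 hy
    exact mem_nonb.2 ⟨(Finset.mem_filter.1 hyc).1, hind c₀ hg₀ c (hMgood c hc) x hx y hyc⟩
  rw [Finset.card_biUnion (fun a ha b hb hab => hdisj a ha b hb hab)] at hle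
  have h3 : ∑ c ∈ M, (D + 1) ≤ ∑ c ∈ M, (r + 1) * (S c).card :=
    Finset.sum_le_sum fun c hc => hScard c (hMgood c hc)
  rw [Finset.sum_const, smul_eq_mul, ← Finset.mul_sum] at h3
  have h4 := Nat.mul_le_mul_left (r + 1) hle
  have h5 := Nat.mul_le_mul_right (D + 1) hMcard
  nlinarith

end KrCore

namespace KrCore
open scoped Classical

variable {V : Type*} [DecidableEq V] {q : ℕ}
variable {G : SimpleGraph V} {W : Finset V} {r D : ℕ}
variable {f : Sym2 V → Fin q}

theorem tot (f : Sym2 V → Fin q) {T : Finset (Finset V)} (hT : IsKrTilingOn G r T W) :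
    2 * tilingEdgeCount T + W.card = W.card * r := by
  rw [edge_total f T, tiling_card hT]
  simp only [count_eq]
  rw [Finset.sum_comm, Finset.mul_sum]
  have : ∀ K ∈ T, 2 * ∑ c, ec f c K + r = r * r := by
    intro K hK
    have h := ec_total f K
    rw [(hT.1 K hK).card_eq] at h
    exact h
  have h2 := Finset.sum_congr rfl this
  rw [Finset.sum_add_distrib] at h2
  simp only [Finset.sum_const, smul_eq_mul] at h2
  rw [h2]; ring

/-- gluing tilings of a disjoint family of sets -/
theorem glue (hr : 0 < r) (F : Finset (Finset V)) (τ : Finset V → Finset (Finset V))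
    (hτ : ∀ S ∈ F, IsKrTilingOn G r (τ S) S)
    (hd : ∀ S ∈ F, ∀ S' ∈ F, S ≠ S' → Disjoint S S')
    {T₀ : Finset (Finset V)} {W₀ : Finset V} (h₀ : IsKrTilingOn G r T₀ W₀)
    (hW : ∀ S ∈ F, Disjoint W₀ S) :
    ∃ T, IsKrTilingOn G r T (W₀ ∪ F.biUnion id) ∧
      ∀ c, tilingColorCount f T c = tilingColorCount f T₀ c + ∑ S ∈ F, tilingColorCount f (τ S) c := by
  induction F using Finset.induction_on with
  | empty => exact ⟨T₀, by simpa using h₀, by simp⟩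
  | insert S F hS ih =>
    obtain ⟨T, hT, hc⟩ := ih (fun A hA => hτ A (mem_insert_of_mem hA))
      (fun A hA B hB => hd A (mem_insert_of_mem hA) B (mem_insert_of_mem hB))
      (fun A hA => hW A (mem_insert_of_mem hA))
    have hdis : Disjoint (W₀ ∪ F.biUnion id) S := by
      rw [Finset.disjoint_union_left, Finset.disjoint_biUnion_left]
      refine ⟨hW S (mem_insert_self _ _), fun A hA => ?_⟩
      exact hd A (mem_insert_of_mem hA) S (mem_insert_self _ _) (fun h => hS (h ▸ hA))
    obtain ⟨h1, h2⟩ := tiling_union hr hT (hτ S (mem_insert_self _ _)) hdis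
    refine ⟨T ∪ τ S, ?_, fun c => ?_⟩
    · have : W₀ ∪ (insert S F).biUnion id = W₀ ∪ F.biUnion id ∪ S := by
        rw [Finset.biUnion_insert]; simp only [id]
        rw [Finset.union_comm S, Finset.union_assoc]
      rw [this]; exact h1
    · rw [count_union f c h2, hc, Finset.sum_insert hS]; ring

/-- gadgets -/
def Gad (G : SimpleGraph V) (r : ℕ) (f : Sym2 V → Fin q) (S : Finset V) : Prop :=
  S.card ≤ 3 * r ∧ ∃ T₁ T₂, IsKrTilingOn G r T₁ S ∧ IsKrTilingOn G r T₂ S ∧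
    ∃ c, tilingColorCount f T₁ c < tilingColorCount f T₂ c

/-- disjoint gadget families -/
def GFam (G : SimpleGraph V) (r : ℕ) (f : Sym2 V → Fin q) (F : Finset (Finset V)) : Prop :=
  (∀ S ∈ F, Gad G r f S) ∧ ∀ S ∈ F, ∀ S' ∈ F, S ≠ S' → Disjoint S S'

theorem gad_nonempty (hr : 0 < r) {S : Finset V} (h : Gad G r f S) : S.Nonempty := by
  obtain ⟨-, T₁, T₂, h1, h2, c, hc⟩ := h
  by_contra hS
  rw [Finset.not_nonempty_iff_eq_empty] at hS
  subst hS
  have a1 := tiling_card h1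
  have a2 := tiling_card h2
  have e1 : T₁ = ∅ := by
    rw [← Finset.card_eq_zero]
    rcases Nat.mul_eq_zero.1 (by simpa using a1.symm : T₁.card * r = 0) with h | h <;> omega
  have e2 : T₂ = ∅ := by
    rw [← Finset.card_eq_zero]
    rcases Nat.mul_eq_zero.1 (by simpa using a2.symm : T₂.card * r = 0) with h | h <;> omega
  subst e1 e2
  exact lt_irrefl _ hc

theorem gfam_exists [Fintype V] (hr : 0 < r) (m : ℕ) :
    ∃ F, GFam G r f F ∧ F.card ≤ m ∧ (F.card < m → NoGad G (univ \ F.biUnion id) r f) := by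
  have hne : ((univ : Finset (Finset (Finset V))).filter
      (fun F => GFam G r f F ∧ F.card ≤ m)).Nonempty :=
    ⟨∅, mem_filter.2 ⟨mem_univ _, ⟨by simp, by simp⟩, by simp⟩⟩
  obtain ⟨F, hF, hmax⟩ := Finset.exists_max_image _ Finset.card hne
  simp only [mem_filter, mem_univ, true_and] at hF hmax
  refine ⟨F, hF.1, hF.2, fun hlt S hS hc T₁ T₂ h1 h2 c => ?_⟩
  by_contra hne
  have hg : Gad G r f S := by
    rcases lt_or_gt_of_ne hne with h | h
    · exact ⟨hc, T₁, T₂, h1, h2, c, h⟩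
    · exact ⟨hc, T₂, T₁, h2, h1, c, h⟩
  have hdis : ∀ A ∈ F, Disjoint S A := by
    intro A hA
    rw [Finset.disjoint_left]
    intro x hx hxA
    exact (mem_sdiff.1 (hS hx)).2 (mem_biUnion.2 ⟨A, hA, hxA⟩)
  have hSF : S ∉ F := by
    intro h
    obtain ⟨x, hx⟩ := gad_nonempty hr hg
    exact Finset.disjoint_left.1 (hdis S h) hx hx
  have := hmax (insert S F) ⟨⟨?_, ?_⟩, by rw [card_insert_of_notMem hSF]; omega⟩
  · rw [card_insert_of_notMem hSF] at this; omega
  · intro A hA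
    rcases mem_insert.1 hA with rfl | h
    · exact hg
    · exact hF.1.1 A h
  · intro A hA B hB hAB
    rcases mem_insert.1 hA with rfl | h <;> rcases mem_insert.1 hB with rfl | h'
    · exact absurd rfl hAB
    · exact hdis B h'
    · exact (hdis A h).symm
    · exact hF.1.2 A h B h' hAB

/-- The combinatorial assembly with abstract numerical parameters. -/
theorem assemble [Fintype V] {lo hi : ℝ} {m : ℕ} (hr : 3 ≤ r) (hq : r * r + r < 2 * q)
    (hdvd : r ∣ Fintype.card V) (hD : LowD G univ D)
    (hbig : r * D + 3 * r + 3 + 3 * r * m ≤ Fintype.card V)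
    (hall : ∀ T, IsKrTilingOn G r T univ → ∀ c : Fin q,
      lo < tilingColorCount f T c ∧ (tilingColorCount f T c : ℝ) < hi)
    (hm : (q : ℝ) * (hi - lo) ≤ m)
    (h1 : ((r : ℝ) - 1) * D ≤ (r + 1) * (lo - 3 * r ^ 2 * m))
    (h2 : 2 * hi ≤ ((r : ℝ) - 1) * ((Fintype.card V : ℝ) - 3 * r * m - r * D)) : False := by
  have hr0 : 0 < r := by omega
  have hr3 : (3 : ℝ) ≤ r := by exact_mod_cast hr
  have hq0 : 0 < q := by nlinarith
  obtain ⟨F, hF, hFm, hng⟩ := gfam_exists (G := G) (f := f) hr0 m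
  have hFm' : (F.card : ℝ) ≤ m := by exact_mod_cast hFm
  set U := F.biUnion id with hU
  have hUc : U.card ≤ 3 * r * m := by
    have : U.card ≤ F.card * (3 * r) :=
      Finset.card_biUnion_le_card_mul _ _ _ (fun S hS => (hF.1 S hS).1)
    nlinarith
  have hex : ∀ S, ∃ T₁ T₂ : Finset (Finset V), ∃ c : Fin q, S ∈ F → IsKrTilingOn G r T₁ S ∧
      IsKrTilingOn G r T₂ S ∧ tilingColorCount f T₁ c < tilingColorCount f T₂ c := by
    intro S
    by_cases h : S ∈ F
    · obtain ⟨-, T₁, T₂, a, b, c, d⟩ := hF.1 S h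
      exact ⟨T₁, T₂, c, fun _ => ⟨a, b, d⟩⟩
    · exact ⟨∅, ∅, ⟨0, hq0⟩, fun h' => absurd h' h⟩
  choose τ₁ τ₂ col hτ using hex
  have hUdvd : r ∣ U.card := by
    rw [hU, Finset.card_biUnion (t := id) (fun A hA B hB hAB => hF.2 A hA B hB hAB)]
    exact Finset.dvd_sum fun S hS => ⟨_, (tiling_card (hτ S hS).1).trans (mul_comm _ _)⟩
  set W := univ \ U with hW
  have hWc : W.card + U.card = Fintype.card V := by
    rw [hW, Finset.card_sdiff_add_card_eq_card (subset_univ _), Finset.card_univ]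
  have hWdvd : r ∣ W.card := (Nat.dvd_add_left hUdvd).1 (hWc ▸ hdvd)
  obtain ⟨D', hD'⟩ := hWdvd
  have hDW : r * D + 3 * r + 3 ≤ W.card := by omega
  have hDD : D ≤ D' := by
    have : r * D ≤ r * D' := by omega
    exact Nat.le_of_mul_le_mul_left this hr0
  obtain ⟨T₀, hT₀⟩ := tile (G := G) (W := W) (r := r) (D := D') (by rw [hD', mul_comm])
    (hD.mono (subset_univ _) hDD)
  have hWU : W ∪ U = univ := by rw [hW]; exact Finset.sdiff_union_of_subset (subset_univ _)
  have hWS : ∀ S ∈ F, Disjoint W S := by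
    intro S hS
    rw [Finset.disjoint_left]
    intro x hx hxS
    exact (mem_sdiff.1 hx).2 (mem_biUnion.2 ⟨S, hS, hxS⟩)
  obtain ⟨T, hT, hTc⟩ := glue (f := f) hr0 F τ₁ (fun S hS => (hτ S hS).1) hF.2 hT₀ hWS
  rw [← hU, hWU] at hT
  rcases hFm.lt_or_eq with hlt | heq
  · refine core ⟨hr, hD.mono (subset_univ _) le_rfl, hDW⟩ (hng hlt) hq hT₀ (fun c => ?_) (fun c => ?_)
    · have hs : ∑ S ∈ F, tilingColorCount f (τ₁ S) c ≤ F.card * (3 * r ^ 2) := by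
        rw [← smul_eq_mul]
        refine Finset.sum_le_card_nsmul _ _ _ fun S hS => ?_
        have a := tot f (hτ S hS).1
        rw [edge_total f] at a
        have b : tilingColorCount f (τ₁ S) c ≤ ∑ c, tilingColorCount f (τ₁ S) c :=
          Finset.single_le_sum (f := fun c => tilingColorCount f (τ₁ S) c)
            (fun _ _ => Nat.zero_le _) (mem_univ c)
        have d := (hF.1 S hS).1
        nlinarith
      have hs' : ((∑ S ∈ F, tilingColorCount f (τ₁ S) c : ℕ) : ℝ) ≤ F.card * (3 * r ^ 2) := by
        exact_mod_cast hs
      have hl := (hall T hT c).1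
      rw [hTc c, Nat.cast_add] at hl
      have hk : lo - 3 * r ^ 2 * m < (tilingColorCount f T₀ c : ℝ) := by nlinarith
      have : ((r : ℝ) - 1) * D < (r + 1) * (tilingColorCount f T₀ c : ℝ) := by nlinarith
      rw [← Nat.cast_lt (α := ℝ)]
      push_cast [Nat.cast_sub (show 1 ≤ r by omega)]
      exact this
    · have hl := (hall T hT c).2
      rw [hTc c, Nat.cast_add] at hl
      have hnn : (0 : ℝ) ≤ ((∑ S ∈ F, tilingColorCount f (τ₁ S) c : ℕ) : ℝ) := Nat.cast_nonneg _
      have hWr : (Fintype.card V : ℝ) - 3 * r * m ≤ W.card := by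
        have e : (W.card : ℝ) + U.card = Fintype.card V := by exact_mod_cast hWc
        have e' : (U.card : ℝ) ≤ 3 * r * m := by exact_mod_cast hUc
        linarith
      have : 2 * (tilingColorCount f T₀ c : ℝ) < ((r : ℝ) - 1) * ((W.card : ℝ) - r * D) := by
        nlinarith
      rw [← Rat.cast_lt (K := ℝ)]
      push_cast
      exact this
  · have key : ∀ c : Fin q, (((F.filter (fun S => col S = c)).card : ℕ) : ℝ) < hi - lo := by
      intro c
      obtain ⟨T', hT', hTc'⟩ := glue (f := f) hr0 F (fun S => if col S = c then τ₂ S else τ₁ S)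
        (fun S hS => by
          split_ifs
          · exact (hτ S hS).2.1
          · exact (hτ S hS).1) hF.2 hT₀ hWS
      rw [← hU, hWU] at hT'
      have a := (hall T hT c).1
      have b := (hall T' hT' c).2
      have hs : ∑ S ∈ F, tilingColorCount f (τ₁ S) c + (F.filter (fun S => col S = c)).card ≤
          ∑ S ∈ F, tilingColorCount f (if col S = c then τ₂ S else τ₁ S) c := by
        rw [Finset.card_filter, ← Finset.sum_add_distrib]
        refine Finset.sum_le_sum fun S hS => ?_
        split_ifs with h
        · have := (hτ S hS).2.2
          rw [h] at this
          exact this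
        · simp
      have hle : tilingColorCount f T c + (F.filter (fun S => col S = c)).card ≤
          tilingColorCount f T' c := by
        rw [hTc, hTc']; omega
      have hle' : (tilingColorCount f T c : ℝ) + (F.filter (fun S => col S = c)).card ≤
          tilingColorCount f T' c := by exact_mod_cast hle
      linarith
    have hsum : (F.card : ℝ) = ∑ c : Fin q, ((F.filter (fun S => col S = c)).card : ℝ) := by
      rw [Finset.card_eq_sum_card_fiberwise (f := col) (t := univ) (fun _ _ => by simp)]
      push_cast; rfl
    have : (F.card : ℝ) < ∑ c : Fin q, (hi - lo) := by
      rw [hsum]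
      exact Finset.sum_lt_sum_of_nonempty ⟨⟨0, hq0⟩, mem_univ _⟩ (fun c _ => key c)
    rw [Finset.sum_const, Finset.card_univ, Fintype.card_fin, nsmul_eq_mul, heq] at this
    linarith

set_option maxHeartbeats 1000000 in
theorem numeric [Fintype V] {ε : ℝ} (hε : 0 < ε) (hr : 3 ≤ r) (hq : 2 * q = r * r + r + 2)
    (hdvd : r ∣ Fintype.card V) (hD : LowD G univ D)
    (hn : 4 * (r : ℝ) ^ 3 ≤ ε * Fintype.card V)
    (hDr : (D : ℝ) ≤ Fintype.card V - (((r : ℝ) ^ 2 + 1) / ((r : ℝ) ^ 2 + r + 2) + ε) *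
      Fintype.card V)
    (hall : ∀ T, IsKrTilingOn G r T univ → ∀ c : Fin q,
      (tilingColorCount f T c : ℝ) <
        ((tilingEdgeCount T : ℝ) + ε / (40 * r ^ 3 * q) * Fintype.card V) / q) : False := by
  set n : ℝ := (Fintype.card V : ℝ) with hndef
  set R : ℝ := (r : ℝ) with hR
  set Q : ℝ := (q : ℝ) with hQ
  have hn0 : 0 ≤ n := Nat.cast_nonneg _
  have hR3 : 3 ≤ R := by rw [hR]; exact_mod_cast hr
  have h2Q : 2 * Q = R * R + R + 2 := by rw [hQ, hR]; exact_mod_cast hq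
  have hQ7 : 7 ≤ Q := by nlinarith
  have hR0 : 0 < R := by linarith
  have hQ0 : 0 < Q := by linarith
  have hR3' : 0 < R ^ 3 := by positivity
  obtain ⟨X, hX⟩ : ∃ X, X = n / (2 * Q) := ⟨_, rfl⟩
  have hX0 : 0 ≤ X := by rw [hX]; positivity
  have hnX : n = X * (R * R + R + 2) := by rw [hX, ← h2Q]; field_simp
  obtain ⟨B, hB⟩ : ∃ B, B = ε * n / (20 * R ^ 3) := ⟨_, rfl⟩
  have hBY : ε * n = 20 * R ^ 3 * B := by rw [hB]; field_simp
  have hB5 : 1 / 5 ≤ B := by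
    rw [hBY] at hn
    nlinarith
  obtain ⟨Z, hZ⟩ : ∃ Z, Z = ε / (40 * R ^ 3 * Q) * n := ⟨_, rfl⟩
  have hZB : 2 * Q * Z = B := by rw [hZ, hB]; field_simp; ring
  have hZ0 : 0 ≤ Z := by rw [hZ]; positivity
  have hZB' : Z ≤ B := by nlinarith
  have hDX : (D : ℝ) ≤ (R + 1) * X - 20 * R ^ 3 * B := by
    have e : (R ^ 2 + 1) / (R ^ 2 + R + 2) * n = (R ^ 2 + 1) * X := by
      have : R ^ 2 + R + 2 ≠ 0 := by positivity
      rw [hnX]; field_simp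
    rw [add_mul, e, hBY] at hDr
    calc (D : ℝ) ≤ _ := hDr
      _ = _ := by rw [hnX]; ring
  have hm := Nat.ceil_lt_add_one (show 0 ≤ B by linarith)
  have hm' := Nat.le_ceil B
  obtain ⟨m, hmd⟩ : ∃ m, m = ⌈B⌉₊ := ⟨_, rfl⟩
  rw [← hmd] at hm hm'
  have hm6 : (m : ℝ) ≤ 6 * B := by linarith
  have hB0 : 0 < B := by linarith
  have hRB : 0 < R * B := by positivity
  have hR2 : 9 ≤ R ^ 2 := by nlinarith
  have hR3B : 27 * B ≤ R ^ 3 * B := by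
    have : 27 ≤ R ^ 3 := by nlinarith
    exact mul_le_mul_of_nonneg_right this hB0.le
  have hR4B : 27 * (R * B) ≤ R ^ 4 * B := by
    have : R ^ 4 * B = R * (R ^ 3 * B) := by ring
    rw [this]; nlinarith
  have hRD : R * D ≤ (R * R + R) * X - 20 * (R ^ 4 * B) := by
    have := mul_le_mul_of_nonneg_left hDX hR0.le
    calc R * D ≤ _ := this
      _ = _ := by ring
  have hRm : R * m ≤ 6 * (R * B) := by
    have := mul_le_mul_of_nonneg_left hm6 hR0.le
    linarith
  refine assemble (G := G) (f := f) (D := D) (m := m) (lo := X * (R - 1) - Z)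
    (hi := X * (R - 1) + Z) hr (by omega) hdvd hD ?_ ?_ ?_ ?_ ?_
  · rw [← Nat.cast_le (α := ℝ)]
    push_cast
    rw [← hndef, ← hR]
    have : 3 * R + 3 ≤ 20 * (R * B) := by nlinarith
    have hn2 : n = (R * R + R) * X + 2 * X := by rw [hnX]; ring
    have hRm3 : 3 * R * m = 3 * (R * m) := by ring
    linarith
  · intro T hT c
    have hup : ∀ c, (tilingColorCount f T c : ℝ) < X * (R - 1) + Z / Q := by
      intro c
      have h := hall T hT c
      rw [← hZ] at h
      have ht : 2 * (tilingEdgeCount T : ℝ) + n = n * R := by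
        have := tot f hT
        rw [Finset.card_univ] at this
        rw [hndef, hR]
        exact_mod_cast this
      have : ((tilingEdgeCount T : ℝ) + Z) / Q = X * (R - 1) + Z / Q := by
        have : (tilingEdgeCount T : ℝ) = Q * (X * (R - 1)) := by
          have : n = 2 * Q * X := by rw [h2Q, hnX]; ring
          rw [this] at ht
          linarith
        rw [this]; field_simp
      rw [this] at h
      exact h
    have hZQ : Z / Q ≤ Z := div_le_self hZ0 (by linarith)
    refine ⟨?_, lt_of_lt_of_le (hup c) (by linarith)⟩
    have ht : 2 * (tilingEdgeCount T : ℝ) + n = n * R := by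
      have := tot f hT
      rw [Finset.card_univ] at this
      rw [hndef, hR]
      exact_mod_cast this
    have he : (tilingEdgeCount T : ℝ) = Q * (X * (R - 1)) := by
      have : n = 2 * Q * X := by rw [h2Q, hnX]; ring
      rw [this] at ht
      linarith
    have hs : (tilingEdgeCount T : ℝ) = ∑ c, (tilingColorCount f T c : ℝ) := by
      rw [edge_total f T]; push_cast; rfl
    rw [← Finset.add_sum_erase _ _ (mem_univ c)] at hs
    have hle : ∑ c ∈ univ.erase c, (tilingColorCount f T c : ℝ) ≤
        ((univ.erase c).card : ℕ) • (X * (R - 1) + Z / Q) :=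
      Finset.sum_le_card_nsmul _ _ _ fun d _ => (hup d).le
    rw [Finset.card_erase_of_mem (mem_univ c), Finset.card_univ, Fintype.card_fin, nsmul_eq_mul,
      Nat.cast_sub (by have := c.pos; omega), Nat.cast_one, ← hQ] at hle
    have hZq : Q * (Z / Q) = Z := by field_simp
    have hZp : 0 < Z / Q := by
      have : 0 < Z := by
        by_contra h
        have : Z = 0 := by linarith
        rw [this] at hZB; linarith
      positivity
    nlinarith
  · have : Q * (X * (R - 1) + Z - (X * (R - 1) - Z)) = 2 * Q * Z := by ring
    rw [← hQ, this, hZB]; exact hm'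
  · rw [← hR]
    have a : (R - 1) * D ≤ (R - 1) * ((R + 1) * X - 20 * R ^ 3 * B) :=
      mul_le_mul_of_nonneg_left hDX (by linarith)
    have hR2B : 3 * (R ^ 2 * B) ≤ R ^ 3 * B := by
      have : R ^ 3 * B = R * (R ^ 2 * B) := by ring
      rw [this]; exact mul_le_mul_of_nonneg_right hR3 (by positivity)
    have b : R ^ 2 * m ≤ 6 * (R ^ 2 * B) := by
      have := mul_le_mul_of_nonneg_left hm6 (sq_nonneg R)
      linarith
    have d : Z + 3 * R ^ 2 * m ≤ 19 * (R ^ 2 * B) := by nlinarith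
    have e : (R + 1) * (Z + 3 * R ^ 2 * m) ≤ (R + 1) * (19 * (R ^ 2 * B)) :=
      mul_le_mul_of_nonneg_left d (by linarith)
    have g : (R + 1) * (19 * (R ^ 2 * B)) ≤ 38 * (R ^ 3 * B) := by
      have : (R + 1) * (19 * (R ^ 2 * B)) = 19 * (R ^ 3 * B) + 19 * (R ^ 2 * B) := by ring
      rw [this]; linarith
    have k : 2 * (20 * (R ^ 3 * B)) ≤ (R - 1) * (20 * (R ^ 3 * B)) :=
      mul_le_mul_of_nonneg_right (by linarith) (by positivity)
    nlinarith
  · rw [← hR, ← hndef]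
    have a : 2 * X + 2 * (R * B) ≤ n - 3 * R * m - R * D := by
      have hn2 : n = (R * R + R) * X + 2 * X := by rw [hnX]; ring
      have hRm3 : 3 * R * m = 3 * (R * m) := by ring
      linarith
    have b : (R - 1) * (2 * X + 2 * (R * B)) ≤ (R - 1) * (n - 3 * R * m - R * D) :=
      mul_le_mul_of_nonneg_left a (by linarith)
    have d : 2 * (2 * (R * B)) ≤ (R - 1) * (2 * (R * B)) :=
      mul_le_mul_of_nonneg_right (by linarith) (by positivity)
    have e : B ≤ R * B := by nlinarith
    nlinarith

end KrCore

/-- **Theorem.** For `r ≥ 3` and `q = C(r+1,2) + 1`, we have `δ_{r,q} ≤ (r²+1)/(r²+r+2)`. -/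
theorem delta_rq_le_at_phase_transition (r q : ℕ) (hr : 3 ≤ r)
    (hq : q = (r + 1) * r / 2 + 1) (ε : ℝ) (hε : 0 < ε) :
    ∃ ζ : ℝ, 0 < ζ ∧ ∃ n₀ : ℕ, ∀ n : ℕ, n₀ ≤ n → r ∣ n →
      ∀ (G : SimpleGraph (Fin n)) [DecidableRel G.Adj],
        (((r : ℝ) ^ 2 + 1) / ((r : ℝ) ^ 2 + r + 2) + ε) * n ≤ G.minDegree →
        ∀ f : Sym2 (Fin n) → Fin q,
          ∃ T : Finset (Finset (Fin n)), IsKrTiling G r T ∧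
            ∃ c : Fin q,
              ((tilingEdgeCount T : ℝ) + ζ * n) / q ≤ (tilingColorCount f T c : ℝ) := by
  have h2q : 2 * q = r * r + r + 2 := by
    have : 2 ∣ (r + 1) * r := by
      rw [mul_comm]; exact (Nat.even_mul_succ_self r).two_dvd
    obtain ⟨k, hk⟩ := this
    have e : (r + 1) * r = r * r + r := by ring
    rw [hk, Nat.mul_div_cancel_left _ (by norm_num)] at hq
    omega
  have hr0 : (0 : ℝ) < r := by exact_mod_cast (by omega : 0 < r)
  have hq0 : (0 : ℝ) < q := by exact_mod_cast (by omega : 0 < q)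
  refine ⟨ε / (40 * r ^ 3 * q), by positivity, ⌈4 * (r : ℝ) ^ 3 / ε⌉₊, ?_⟩
  intro n hn hdvd G _ hdeg f
  by_contra hcon
  push Not at hcon
  have hn' : 4 * (r : ℝ) ^ 3 / ε ≤ n := Nat.ceil_le.1 hn
  rw [div_le_iff₀ hε] at hn'
  have hLow : KrCore.LowD G univ (n - G.minDegree) := by
    intro x _
    have h1 : KrCore.nonb G x univ ∪ G.neighborFinset x = univ := by
      ext y
      simp only [mem_union, KrCore.mem_nonb, mem_univ, true_and, SimpleGraph.mem_neighborFinset,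
        iff_true]
      tauto
    have hdis : Disjoint (KrCore.nonb G x univ) (G.neighborFinset x) := by
      rw [Finset.disjoint_left]
      intro y hy hy'
      exact (KrCore.mem_nonb.1 hy).2 ((SimpleGraph.mem_neighborFinset _ _ _).1 hy')
    have h2 := Finset.card_union_of_disjoint hdis
    rw [h1, Finset.card_univ, Fintype.card_fin, SimpleGraph.card_neighborFinset_eq_degree] at h2
    have := G.minDegree_le_degree x
    omega
  have hle : G.minDegree ≤ n := by
    rcases Nat.eq_zero_or_pos n with h0 | h0
    · subst h0
      simp [SimpleGraph.minDegree]
    · have := G.minDegree_le_degree ⟨0, h0⟩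
      have h2 := G.degree_lt_card_verts ⟨0, h0⟩
      rw [Fintype.card_fin] at h2
      omega
  refine KrCore.numeric (G := G) (f := f) (D := n - G.minDegree) hε hr h2q
    (by rwa [Fintype.card_fin]) hLow ?_ ?_ ?_
  · rw [Fintype.card_fin]; linarith
  · rw [Fintype.card_fin, Nat.cast_sub hle]; linarith
  · intro T hT c
    rw [Fintype.card_fin]
    exact hcon T hT c
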